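/- There exist maximal 1-planar graphs on n vertices with only (45/17)n − 84/17 edges; in particular, for infinitely many n there is a 1-planar graph G on n vertices with exactly (45n − 84)/17 edges such that adding any edge to G destroys 1-planarity. -/

import Mathlib

open Set

noncomputable section

/-- The Euclidean plane, where graphs are drawn. -/
abbrev Plane : Type := ℝ × ℝ

/-- A drawing of a multigraph on vertex type `V` with edges indexed by `E`,
`ends e` being the (unordered) pair of endpoints of `e`.  Vertices are distinct
points, edges are simple Jordan arcs joining their endpoints, arcs avoid vertices
in their interior, and edges sharing an endpoint do not cross. -/
structure MultiDrawing (V E : Type) (ends : E → Sym2 V) where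
  pos : V → Plane
  pos_inj : Function.Injective pos
  arc : E → ℝ → Plane
  arc_cont : ∀ e, ContinuousOn (arc e) (Icc (0:ℝ) 1)
  arc_inj : ∀ e, InjOn (arc e) (Icc (0:ℝ) 1)
  arc_ends : ∀ e, ∃ u v : V, ends e = s(u, v) ∧ arc e 0 = pos u ∧ arc e 1 = pos v
  arc_avoid : ∀ e, ∀ w : V, pos w ∉ arc e '' Ioo (0:ℝ) 1
  no_incident_cross : ∀ e f, e ≠ f →
    (arc e '' Ioo (0:ℝ) 1 ∩ arc f '' Ioo (0:ℝ) 1).Nonempty →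
    ∀ x : V, ¬(x ∈ ends e ∧ x ∈ ends f)

namespace MultiDrawing

variable {V E : Type} {ends : E → Sym2 V}

/-- The interior (open part) of the arc of edge `e`. -/
def inter (D : MultiDrawing V E ends) (e : E) : Set Plane := D.arc e '' Ioo (0:ℝ) 1

/-- The crossings of edge `e`: pairs of another edge and a common interior point. -/
def crossSet (D : MultiDrawing V E ends) (e : E) : Set (E × Plane) :=
  {fp | fp.1 ≠ e ∧ fp.2 ∈ D.inter e ∩ D.inter fp.1}

/-- A planar drawing: no edge is crossed. -/
def IsPlanarD (D : MultiDrawing V E ends) : Prop := ∀ e, D.crossSet e = ∅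

/-- A 1-planar drawing: each edge is crossed at most once. -/
def IsOnePlanarD (D : MultiDrawing V E ends) : Prop := ∀ e, (D.crossSet e).Subsingleton

/-- The point set occupied by the drawing. -/
def image (D : MultiDrawing V E ends) : Set Plane :=
  range D.pos ∪ ⋃ e, D.arc e '' Icc (0:ℝ) 1

/-- A face of a drawing: a connected component of the complement of its image. -/
def IsFace (D : MultiDrawing V E ends) (F : Set Plane) : Prop :=
  ∃ p, p ∉ D.image ∧ F = connectedComponentIn D.imageᶜ p

/-- A triangulated drawing: the boundary of each face meets (segments of) exactly
three edges. -/
def IsTriangulated (D : MultiDrawing V E ends) : Prop :=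
  ∀ F : Set Plane, D.IsFace F →
    {e : E | (frontier F ∩ D.arc e '' Icc (0:ℝ) 1).Nonempty}.ncard = 3

end MultiDrawing

/-- A drawing of a simple graph: arcs indexed by its edge set. -/
abbrev SimpleGraph.Drawing {V : Type} (G : SimpleGraph V) : Type :=
  MultiDrawing V ↥G.edgeSet (fun e => (e : Sym2 V))

/-- A graph is 1-planar if it has a drawing with at most one crossing per edge. -/
def SimpleGraph.IsOnePlanar {V : Type} (G : SimpleGraph V) : Prop :=
  ∃ D : G.Drawing, D.IsOnePlanarD

/-- A graph is planar if it has a crossing-free drawing. -/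
def SimpleGraph.IsPlanarGraph {V : Type} (G : SimpleGraph V) : Prop :=
  ∃ D : G.Drawing, D.IsPlanarD

/-- Points of the sphere. -/
abbrev SpherePt : Type := ↥(Metric.sphere (0 : EuclideanSpace ℝ (Fin 3)) 1)

/-- A subset of the sphere that is homeomorphic to a closed disk. -/
def IsClosedDisk (s : Set SpherePt) : Prop :=
  Nonempty (↥s ≃ₜ ↥(Metric.closedBall (0 : Plane) 1))

/-- A map: a partition of the sphere into closed-disk regions with pairwise
disjoint interiors, some of which are labeled as countries. -/
structure SphereMap (C : Type) where
  region : C → Set SpherePt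
  country : C → Prop
  disk : ∀ c, IsClosedDisk (region c)
  int_disjoint : ∀ c d : C, c ≠ d → interior (region c) ∩ interior (region d) = ∅
  cover : ⋃ c, region c = Set.univ

/-- A `k`-map: at most `k` regions meet at any point. -/
def SphereMap.IsKMap {C : Type} (M : SphereMap C) (k : ℕ) : Prop :=
  ∀ p : SpherePt, {c : C | p ∈ M.region c}.ncard ≤ k

/-- A hole-free map: every region is a country. -/
def SphereMap.HoleFree {C : Type} (M : SphereMap C) : Prop := ∀ c, M.country c

/-- `G` is the map graph of `M`: its vertices correspond to the countries of `M`,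
with edges given by touching countries. -/
def IsMapGraphOf {V C : Type} (G : SimpleGraph V) (M : SphereMap C) : Prop :=
  ∃ φ : V ≃ {c : C // M.country c},
    ∀ u v : V, G.Adj u v ↔ u ≠ v ∧ (M.region (φ u) ∩ M.region (φ v)).Nonempty

/-- `G` is a map graph. -/
def IsMapGraph {V : Type} (G : SimpleGraph V) : Prop :=
  ∃ (C : Type) (_ : Finite C) (M : SphereMap C), IsMapGraphOf G M

/-- `G` is a `k`-map graph. -/
def IsKMapGraph {V : Type} (G : SimpleGraph V) (k : ℕ) : Prop :=
  ∃ (C : Type) (_ : Finite C) (M : SphereMap C), M.IsKMap k ∧ IsMapGraphOf G M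

/-- `G` is a hole-free `k`-map graph. -/
def IsHoleFreeKMapGraph {V : Type} (G : SimpleGraph V) (k : ℕ) : Prop :=
  ∃ (C : Type) (_ : Finite C) (M : SphereMap C),
    M.HoleFree ∧ M.IsKMap k ∧ IsMapGraphOf G M

/-- A maximal 1-planar graph: 1-planar, and adding any edge destroys
1-planarity. -/
def MaximalOnePlanar {V : Type} (G : SimpleGraph V) : Prop :=
  G.IsOnePlanar ∧ ∀ H : SimpleGraph V, G < H → ¬H.IsOnePlanar

/-! ### Part 1: parity of crossings -/

/-- Height at abscissa `x` of the line through `p` and `q`. -/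
def lineY (p q : Plane) (x : ℝ) : ℝ := p.2 + (q.2 - p.2) / (q.1 - p.1) * (x - p.1)

lemma lineY_swap {p q : Plane} (h : p.1 ≠ q.1) (x : ℝ) : lineY p q x = lineY q p x := by
  have h1 : q.1 - p.1 ≠ 0 := sub_ne_zero.2 (Ne.symm h)
  have h2 : p.1 - q.1 ≠ 0 := sub_ne_zero.2 h
  have h3 : (q.2 - p.2) / (q.1 - p.1) = (p.2 - q.2) / (p.1 - q.1) := by
    rw [div_eq_div_iff h1 h2]; ring
  unfold lineY
  rw [h3]
  field_simp
  ring

open Classical in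
/-- `a` lies below the segment `pq`. -/
def bel (p q a : Plane) : ZMod 2 :=
  if ((p.1 ≤ a.1 ∧ a.1 < q.1) ∨ (q.1 ≤ a.1 ∧ a.1 < p.1)) ∧ a.2 < lineY p q a.1 then 1 else 0

open Classical in
/-- `a` lies above the segment `pq`. -/
def abv (p q a : Plane) : ZMod 2 :=
  if ((p.1 < a.1 ∧ a.1 ≤ q.1) ∨ (q.1 < a.1 ∧ a.1 ≤ p.1)) ∧ lineY p q a.1 < a.2 then 1 else 0

open Classical in
/-- Lexicographic order indicator. -/
def tau (a p : Plane) : ZMod 2 := if p.1 < a.1 ∨ (p.1 = a.1 ∧ a.2 < p.2) then 1 else 0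

lemma bel_vert {p q : Plane} (h : p.1 = q.1) (a : Plane) : bel p q a = 0 := by
  unfold bel
  rw [if_neg]
  rintro ⟨⟨h1, h2⟩ | ⟨h1, h2⟩, -⟩ <;> linarith

lemma abv_vert {p q : Plane} (h : p.1 = q.1) (a : Plane) : abv p q a = 0 := by
  unfold abv
  rw [if_neg]
  rintro ⟨⟨h1, h2⟩ | ⟨h1, h2⟩, -⟩ <;> linarith

lemma bel_swap (p q a : Plane) : bel p q a = bel q p a := by
  by_cases h : p.1 = q.1
  · rw [bel_vert h, bel_vert h.symm]
  · unfold bel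
    congr 1
    rw [lineY_swap h]
    exact propext (and_congr_left fun _ => or_comm)

lemma abv_swap (p q a : Plane) : abv p q a = abv q p a := by
  by_cases h : p.1 = q.1
  · rw [abv_vert h, abv_vert h.symm]
  · unfold abv
    congr 1
    rw [lineY_swap h]
    exact propext (and_congr_left fun _ => or_comm)

lemma mem_segment_lineY {p q : Plane} (h : p.1 < q.1) {x : ℝ} (h1 : p.1 ≤ x) (h2 : x ≤ q.1) :
    ((x, lineY p q x) : Plane) ∈ segment ℝ p q := by
  have h3 : 0 < q.1 - p.1 := sub_pos.2 h
  rw [segment_eq_image']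
  refine ⟨(x - p.1) / (q.1 - p.1), ⟨div_nonneg (by linarith) h3.le, ?_⟩, ?_⟩
  · rw [div_le_one h3]; linarith
  · ext
    · simp only [Prod.fst_add, Prod.smul_fst, Prod.fst_sub, smul_eq_mul]
      field_simp
      ring
    · simp only [Prod.snd_add, Prod.smul_snd, Prod.snd_sub, smul_eq_mul, lineY]
      ring

lemma lineY_cont (p q : Plane) : Continuous (lineY p q) := by
  unfold lineY; fun_prop

lemma lineY_left (p q : Plane) : lineY p q p.1 = p.2 := by simp [lineY]

lemma lineY_right {p q : Plane} (h : p.1 < q.1) : lineY p q q.1 = q.2 := by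
  have : q.1 - p.1 ≠ 0 := by linarith [sub_pos.2 h]
  unfold lineY; field_simp; ring

/-- Over a common range of abscissas, disjoint segments do not swap their order. -/
lemma order_const {p q a b : Plane} (hpq : p.1 < q.1) (hab : a.1 < b.1)
    (hd : Disjoint (segment ℝ p q) (segment ℝ a b)) {x y : ℝ} (hxp : p.1 ≤ x) (hxa : a.1 ≤ x)
    (hyq : y ≤ q.1) (hyb : y ≤ b.1) (hxy : x ≤ y) :
    (lineY a b x < lineY p q x ↔ lineY a b y < lineY p q y) := by
  have key : ∀ z ∈ Icc x y, lineY p q z - lineY a b z ≠ 0 := by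
    intro z hz h0
    refine Set.disjoint_left.1 hd (mem_segment_lineY hpq (hxp.trans hz.1) (hz.2.trans hyq)) ?_
    rw [sub_eq_zero.1 h0]
    exact mem_segment_lineY hab (hxa.trans hz.1) (hz.2.trans hyb)
  have hc : ContinuousOn (fun z => lineY p q z - lineY a b z) (Icc x y) :=
    ((lineY_cont p q).sub (lineY_cont a b)).continuousOn
  constructor
  · intro h
    by_contra h'
    obtain ⟨z, hz, hz0⟩ := intermediate_value_Icc' hxy hc
      (show (0:ℝ) ∈ Icc _ _ from ⟨by linarith, by linarith⟩)
    exact key z hz hz0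
  · intro h
    by_contra h'
    obtain ⟨z, hz, hz0⟩ := intermediate_value_Icc hxy hc
      (show (0:ℝ) ∈ Icc _ _ from ⟨by linarith, by linarith⟩)
    exact key z hz hz0

lemma vert_mem {p q : Plane} (h : p.1 = q.1) {y : ℝ} (h1 : p.2 ≤ y) (h2 : y ≤ q.2) :
    ((p.1, y) : Plane) ∈ segment ℝ p q := by
  rcases eq_or_lt_of_le (h1.trans h2) with h3 | h3
  · have : y = p.2 := le_antisymm (h2.trans h3.ge) h1
    subst this
    exact left_mem_segment ℝ p q
  · have h4 : 0 < q.2 - p.2 := sub_pos.2 h3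
    rw [segment_eq_image']
    refine ⟨(y - p.2) / (q.2 - p.2), ⟨div_nonneg (by linarith) h4.le, ?_⟩, ?_⟩
    · rw [div_le_one h4]; linarith
    · ext
      · simp [h]
      · simp only [Prod.snd_add, Prod.smul_snd, Prod.snd_sub, smul_eq_mul]
        field_simp
        ring

lemma zmod2_self (x : ZMod 2) : x + x = 0 := CharTwo.add_self_eq_zero x

lemma cross_parity_aux {p q a b : Plane} (hpq : p.1 < q.1) (hab : a.1 < b.1)
    (hd : Disjoint (segment ℝ p q) (segment ℝ a b)) :
    bel p q a + bel p q b + abv a b p + abv a b q = 0 := by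
  by_cases h1 : a.1 < q.1
  swap
  · simp only [bel, abv]
    rw [if_neg, if_neg, if_neg, if_neg]
    · simp
    all_goals (rintro ⟨⟨_, _⟩ | ⟨_, _⟩, -⟩ <;> linarith)
  by_cases h2 : p.1 ≤ b.1
  swap
  · simp only [bel, abv]
    rw [if_neg, if_neg, if_neg, if_neg]
    · simp
    all_goals (rintro ⟨⟨_, _⟩ | ⟨_, _⟩, -⟩ <;> linarith)
  have L := fun x y => @order_const p q a b hpq hab hd x y
  -- the left contribution
  have hl : ∀ x, x = max p.1 a.1 → bel p q a + abv a b p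
      = @ite _ (lineY a b x < lineY p q x) (Classical.propDecidable _) 1 0 := by
    intro x hx
    unfold bel abv
    rcases le_or_gt p.1 a.1 with h | h
    · rw [max_eq_right h] at hx
      subst hx
      rw [lineY_left]
      have : ¬ (((a.1 < p.1 ∧ p.1 ≤ b.1) ∨ (b.1 < p.1 ∧ p.1 ≤ a.1)) ∧ lineY a b p.1 < p.2) := by
        rintro ⟨⟨_, _⟩ | ⟨_, _⟩, -⟩ <;> linarith
      rw [if_neg this, add_zero]
      congr 1
      simp [h, h1]
    · rw [max_eq_left h.le] at hx
      subst hx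
      rw [lineY_left]
      have : ¬ (((p.1 ≤ a.1 ∧ a.1 < q.1) ∨ (q.1 ≤ a.1 ∧ a.1 < p.1)) ∧ a.2 < lineY p q a.1) := by
        rintro ⟨⟨_, _⟩ | ⟨_, _⟩, -⟩ <;> linarith
      rw [if_neg this, zero_add]
      congr 1
      simp [h, h2]
  have hr : ∀ x, x = min q.1 b.1 → bel p q b + abv a b q
      = @ite _ (lineY a b x < lineY p q x) (Classical.propDecidable _) 1 0 := by
    intro x hx
    unfold bel abv
    rcases le_or_gt q.1 b.1 with h | h
    · rw [min_eq_left h] at hx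
      subst hx
      rw [lineY_right hpq]
      have : ¬ (((p.1 ≤ b.1 ∧ b.1 < q.1) ∨ (q.1 ≤ b.1 ∧ b.1 < p.1)) ∧ b.2 < lineY p q b.1) := by
        rintro ⟨⟨_, _⟩ | ⟨_, _⟩, -⟩ <;> linarith
      rw [if_neg this, zero_add]
      congr 1
      simp [h, h1]
    · rw [min_eq_right h.le] at hx
      subst hx
      rw [lineY_right hab]
      have : ¬ (((a.1 < q.1 ∧ q.1 ≤ b.1) ∨ (b.1 < q.1 ∧ q.1 ≤ a.1)) ∧ lineY a b q.1 < q.2) := by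
        rintro ⟨⟨_, _⟩ | ⟨_, _⟩, -⟩ <;> linarith
      rw [if_neg this, add_zero]
      congr 1
      simp [h, h2]
  have hlr := L (max p.1 a.1) (min q.1 b.1) (le_max_left _ _) (le_max_right _ _)
    (min_le_left _ _) (min_le_right _ _)
    (max_le (le_min hpq.le h2) (le_min h1.le hab.le))
  have e : bel p q a + bel p q b + abv a b p + abv a b q
    = (bel p q a + abv a b p) + (bel p q b + abv a b q) := by ring
  rw [e, hl _ rfl, hr _ rfl]
  by_cases h : lineY a b (max p.1 a.1) < lineY p q (max p.1 a.1)
  · rw [if_pos h, if_pos (hlr.1 h)]; exact zmod2_self 1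
  · rw [if_neg h, if_neg (fun h' => h (hlr.2 h'))]; simp

lemma vert_parity {p q a b : Plane} (hpq : p.1 = q.1) (hab : a.1 < b.1)
    (hd : Disjoint (segment ℝ p q) (segment ℝ a b)) : abv a b p = abv a b q := by
  unfold abv
  rw [← hpq]
  by_cases hx : a.1 < p.1 ∧ p.1 ≤ b.1
  swap
  · have : ¬ (b.1 < p.1 ∧ p.1 ≤ a.1) := fun h => by linarith [h.1, h.2]
    simp [hx, this]
  have hm := mem_segment_lineY hab hx.1.le hx.2
  have key : lineY a b p.1 < p.2 ↔ lineY a b p.1 < q.2 := by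
    constructor
    · intro h
      by_contra h'
      have : ((q.1, lineY a b p.1) : Plane) ∈ segment ℝ q p :=
        vert_mem hpq.symm (not_lt.1 h') h.le
      rw [segment_symm, ← hpq] at this
      exact Set.disjoint_left.1 hd this hm
    · intro h
      by_contra h'
      exact Set.disjoint_left.1 hd (vert_mem hpq (not_lt.1 h') h.le) hm
  simp [key]

lemma vert_parity' {p q a b : Plane} (hpq : p.1 = q.1) (hab : a.1 < b.1)
    (hd : Disjoint (segment ℝ p q) (segment ℝ a b)) : bel a b p = bel a b q := by
  unfold bel
  rw [← hpq]
  by_cases hx : a.1 ≤ p.1 ∧ p.1 < b.1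
  swap
  · have : ¬ (b.1 ≤ p.1 ∧ p.1 < a.1) := fun h => by linarith [h.1, h.2]
    simp [hx, this]
  have hm := mem_segment_lineY hab hx.1 hx.2.le
  have key : p.2 < lineY a b p.1 ↔ q.2 < lineY a b p.1 := by
    constructor
    · intro h
      by_contra h'
      exact Set.disjoint_left.1 hd (vert_mem hpq h.le (not_lt.1 h')) hm
    · intro h
      by_contra h'
      have : ((q.1, lineY a b p.1) : Plane) ∈ segment ℝ q p :=
        vert_mem hpq.symm h.le (not_lt.1 h')
      rw [segment_symm, ← hpq] at this
      exact Set.disjoint_left.1 hd this hm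
  simp [key]

/-- Disjoint segments have even crossing parity. -/
lemma cross_parity {p q a b : Plane} (hd : Disjoint (segment ℝ p q) (segment ℝ a b)) :
    bel p q a + bel p q b + abv a b p + abv a b q = 0 := by
  wlog hpq : p.1 ≤ q.1 generalizing p q
  · have := this (p := q) (q := p) (by rwa [segment_symm]) (not_le.1 hpq).le
    rw [bel_swap p q, bel_swap p q, ← this]; ring
  wlog hab : a.1 ≤ b.1 generalizing a b
  · have := this (a := b) (b := a) (by rwa [segment_symm ℝ b a]) (not_le.1 hab).le
    rw [abv_swap a b, abv_swap a b, ← this]; ring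
  rcases eq_or_lt_of_le hpq with h1 | h1
  · rw [bel_vert h1, bel_vert h1]
    rcases eq_or_lt_of_le hab with h2 | h2
    · rw [abv_vert h2, abv_vert h2]; simp
    · rw [vert_parity h1 h2 hd]; simp [zmod2_self]
  · rcases eq_or_lt_of_le hab with h2 | h2
    · rw [abv_vert h2, abv_vert h2, vert_parity' h2 h1 hd.symm]; simp [zmod2_self]
    · exact cross_parity_aux h1 h2 hd

/-- A point off a segment: relation between the two counts. -/
lemma bel_add_abv {p q a : Plane} (ha : a ∉ segment ℝ p q) :
    bel p q a + abv p q a = tau a p + tau a q := by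
  wlog hpq : p.1 ≤ q.1 generalizing p q
  · have := this (p := q) (q := p) (by rwa [segment_symm]) (not_le.1 hpq).le
    rw [bel_swap p q, abv_swap p q, this]; ring
  rcases eq_or_lt_of_le hpq with h1 | h1
  · rw [bel_vert h1, abv_vert h1]
    unfold tau
    rw [← h1]
    by_cases h2 : p.1 = a.1
    · have h3 : ¬ p.1 < a.1 := by linarith
      simp only [h3, h2, lt_irrefl, false_or, true_and]
      by_cases h4 : a.2 < p.2 <;> by_cases h5 : a.2 < q.2
      · simp [h4, h5, zmod2_self]
      · exfalso; apply ha
        have : ((q.1, a.2) : Plane) ∈ segment ℝ q p := vert_mem h1.symm (not_lt.1 h5) h4.le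
        rw [segment_symm, ← h1, h2] at this
        exact this
      · exfalso; apply ha
        have : ((p.1, a.2) : Plane) ∈ segment ℝ p q := vert_mem h1 (not_lt.1 h4) h5.le
        rw [h2] at this
        exact this
      · simp [h4, h5]
    · by_cases h3 : p.1 < a.1 <;> simp [h2, h3, zmod2_self]
  · by_cases hr : p.1 ≤ a.1 ∧ a.1 ≤ q.1
    swap
    · have : ¬ (p.1 ≤ a.1 ∧ a.1 < q.1) := fun h => hr ⟨h.1, h.2.le⟩
      have : ¬ (p.1 < a.1 ∧ a.1 ≤ q.1) := fun h => hr ⟨h.1.le, h.2⟩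
      have : ¬ (q.1 ≤ a.1 ∧ a.1 < p.1) := fun h => by linarith [h.1, h.2]
      have : ¬ (q.1 < a.1 ∧ a.1 ≤ p.1) := fun h => by linarith [h.1, h.2]
      simp only [bel, abv, tau, *]
      rw [not_and_or, not_le, not_le] at hr
      rcases hr with h | h
      · have e1 : ¬ p.1 < a.1 := by linarith
        have e2 : ¬ q.1 < a.1 := by linarith
        have e3 : ¬ p.1 = a.1 := by intro h; linarith
        have e4 : ¬ q.1 = a.1 := by intro h; linarith
        simp [e1, e2, e3, e4]
      · have e1 : p.1 < a.1 := by linarith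
        simp [e1, h, zmod2_self]
    have hne : a.2 ≠ lineY p q a.1 := by
      intro h
      apply ha
      have := mem_segment_lineY h1 hr.1 hr.2
      rwa [← h] at this
    have n1 : ¬ (q.1 ≤ a.1 ∧ a.1 < p.1) := fun h => by linarith [h.1, h.2]
    have n2 : ¬ (q.1 < a.1 ∧ a.1 ≤ p.1) := fun h => by linarith [h.1, h.2]
    rcases eq_or_lt_of_le hr.1 with h2 | h2
    · have e : lineY p q a.1 = p.2 := by rw [← h2, lineY_left]
      have e0 : a.1 < q.1 := by linarith
      have e1 : ¬ q.1 < a.1 := by linarith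
      have e2 : ¬ q.1 = a.1 := by intro h; linarith
      have e3 : ¬ a.1 < p.1 := by linarith
      simp only [bel, abv, tau, e, n2, e0, e1, e2, h2]
      simp
    · rcases eq_or_lt_of_le hr.2 with h3 | h3
      · have e : lineY p q a.1 = q.2 := by rw [h3, lineY_right h1]
        rw [e] at hne
        have e0 : ¬ q.1 < a.1 := by linarith
        have e1 : ¬ a.1 < p.1 := by linarith
        have e2 : ¬ q.1 < p.1 := by linarith
        have e' : lineY p q q.1 = q.2 := lineY_right h1
        simp only [bel, abv, tau, h3, e']
        rcases lt_or_gt_of_ne hne with h4 | h4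
        · have : ¬ q.2 < a.2 := by linarith
          simp [h1, h4, this, e2, zmod2_self]
        · have : ¬ a.2 < q.2 := by linarith
          simp [h1, h4, this, e2]
      · have e1 : ¬ q.1 < a.1 := by linarith
        have e2 : ¬ q.1 = a.1 := by intro h; linarith
        simp only [bel, abv, tau, n1, n2, e1, e2, h2, h3, hr]
        rcases lt_or_gt_of_ne hne with h4 | h4
        · have : ¬ lineY p q a.1 < a.2 := by linarith
          simp [h4, this]
        · have : ¬ a.2 < lineY p q a.1 := by linarith
          simp [h4, this]

lemma tau_anti {a p : Plane} (h : a ≠ p) : tau a p + tau p a = 1 := by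
  unfold tau
  rcases lt_trichotomy p.1 a.1 with h1 | h1 | h1
  · have e1 : ¬ a.1 < p.1 := by linarith
    have e2 : ¬ a.1 = p.1 := by intro h; linarith
    simp [h1, e1, e2]
  · have h2 : a.2 ≠ p.2 := fun h2 => h (Prod.ext h1.symm h2)
    rcases lt_or_gt_of_ne h2 with h3 | h3
    · have : ¬ p.2 < a.2 := by linarith
      simp [h1, h3, this]
    · have : ¬ a.2 < p.2 := by linarith
      simp [h1, h3, this]
  · have e1 : ¬ p.1 < a.1 := by linarith
    have e2 : ¬ p.1 = a.1 := by intro h; linarith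
    simp [h1, e1, e2]

/-- The `i`-th point of the `N`-step polygonal approximation of `γ`. -/
def ptN (γ : ℝ → Plane) (N i : ℕ) : Plane := γ ((i : ℝ) / N)

/-- Number (mod 2) of pieces of the polygon above `a`. -/
def cB (γ : ℝ → Plane) (N : ℕ) (a : Plane) : ZMod 2 :=
  ∑ i ∈ Finset.range N, bel (ptN γ N i) (ptN γ N (i + 1)) a

/-- Number (mod 2) of pieces of the polygon below `a`. -/
def cA (γ : ℝ → Plane) (N : ℕ) (a : Plane) : ZMod 2 :=
  ∑ i ∈ Finset.range N, abv (ptN γ N i) (ptN γ N (i + 1)) a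

lemma tele2 (g : ℕ → ZMod 2) (N : ℕ) :
    ∑ i ∈ Finset.range N, (g i + g (i + 1)) = g 0 + g N := by
  induction N with
  | zero => simp [zmod2_self]
  | succ n ih =>
    rw [Finset.sum_range_succ, ih]
    linear_combination zmod2_self (g n)

lemma poly_parity {γ δ : ℝ → Plane} {N : ℕ}
    (h : ∀ i < N, ∀ j < N, Disjoint (segment ℝ (ptN γ N i) (ptN γ N (i + 1)))
      (segment ℝ (ptN δ N j) (ptN δ N (j + 1)))) :
    cB γ N (ptN δ N 0) + cB γ N (ptN δ N N) + cA δ N (ptN γ N 0) + cA δ N (ptN γ N N) = 0 := by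
  have h1 : ∑ i ∈ Finset.range N, ∑ j ∈ Finset.range N,
      ((bel (ptN γ N i) (ptN γ N (i + 1)) (ptN δ N j) +
        bel (ptN γ N i) (ptN γ N (i + 1)) (ptN δ N (j + 1))) +
      (abv (ptN δ N j) (ptN δ N (j + 1)) (ptN γ N i) +
        abv (ptN δ N j) (ptN δ N (j + 1)) (ptN γ N (i + 1)))) = 0 := by
    refine Finset.sum_eq_zero fun i hi => Finset.sum_eq_zero fun j hj => ?_
    rw [← cross_parity (h i (Finset.mem_range.1 hi) j (Finset.mem_range.1 hj))]
    ring
  simp only [Finset.sum_add_distrib] at h1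
  rw [← Finset.sum_add_distrib, ← Finset.sum_add_distrib] at h1
  have h2 : ∑ i ∈ Finset.range N, (∑ j ∈ Finset.range N,
        bel (ptN γ N i) (ptN γ N (i + 1)) (ptN δ N j) + ∑ j ∈ Finset.range N,
        bel (ptN γ N i) (ptN γ N (i + 1)) (ptN δ N (j + 1)))
      = cB γ N (ptN δ N 0) + cB γ N (ptN δ N N) := by
    rw [cB, cB, ← Finset.sum_add_distrib]
    refine Finset.sum_congr rfl fun i _ => ?_
    rw [← Finset.sum_add_distrib, tele2 (fun j => bel (ptN γ N i) (ptN γ N (i + 1)) (ptN δ N j))]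
  have h3 : ∑ i ∈ Finset.range N, (∑ j ∈ Finset.range N,
        abv (ptN δ N j) (ptN δ N (j + 1)) (ptN γ N i) + ∑ j ∈ Finset.range N,
        abv (ptN δ N j) (ptN δ N (j + 1)) (ptN γ N (i + 1)))
      = cA δ N (ptN γ N 0) + cA δ N (ptN γ N N) := by
    exact tele2 (fun i => cA δ N (ptN γ N i)) N
  have h4 : cB γ N (ptN δ N 0) + cB γ N (ptN δ N N) +
      (cA δ N (ptN γ N 0) + cA δ N (ptN γ N N)) = 0 := by
    rw [← h2, ← h3]; exact h1
  rw [← h4]; ring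

lemma cB_add_cA {γ : ℝ → Plane} {N : ℕ} {a : Plane}
    (h : ∀ i < N, a ∉ segment ℝ (ptN γ N i) (ptN γ N (i + 1))) :
    cB γ N a + cA γ N a = tau a (ptN γ N 0) + tau a (ptN γ N N) := by
  rw [cB, cA, ← Finset.sum_add_distrib, ← tele2 (fun i => tau a (ptN γ N i))]
  exact Finset.sum_congr rfl fun i hi => bel_add_abv (h i (Finset.mem_range.1 hi))

lemma seg_sub_open {γ : ℝ → Plane} (hγ : ContinuousOn γ (Icc 0 1)) {U : Set Plane}
    (hU : IsOpen U) (h : γ '' Icc 0 1 ⊆ U) :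
    ∀ᶠ N : ℕ in Filter.atTop, ∀ i < N, segment ℝ (ptN γ N i) (ptN γ N (i + 1)) ⊆ U := by
  have hc : IsCompact (γ '' Icc 0 1) := isCompact_Icc.image_of_continuousOn hγ
  obtain ⟨ε, hε, hεU⟩ := hc.exists_thickening_subset_open hU h
  have hu := isCompact_Icc.uniformContinuousOn_of_continuous hγ
  rw [Metric.uniformContinuousOn_iff] at hu
  obtain ⟨δ, hδ, hd⟩ := hu ε hε
  obtain ⟨N₀, hN₀⟩ := exists_nat_gt (1 / δ)
  filter_upwards [Filter.eventually_ge_atTop (max N₀ 1)] with N hN i hi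
  have hN1 : (0 : ℝ) < N := by
    have : 1 ≤ N := (le_max_right _ _).trans hN
    exact_mod_cast this
  have hN2 : 1 / δ < N := hN₀.trans_le (by exact_mod_cast (le_max_left _ _).trans hN)
  have hi' : (i : ℝ) + 1 ≤ N := by exact_mod_cast hi
  have hi0 : (0 : ℝ) ≤ i := Nat.cast_nonneg i
  have m1 : (i : ℝ) / N ∈ Icc (0 : ℝ) 1 :=
    ⟨div_nonneg hi0 hN1.le, by rw [div_le_one hN1]; linarith⟩
  have m2 : ((i + 1 : ℕ) : ℝ) / N ∈ Icc (0 : ℝ) 1 := by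
    push_cast
    exact ⟨div_nonneg (by linarith) hN1.le, by rw [div_le_one hN1]; linarith⟩
  have hlt : dist (((i + 1 : ℕ) : ℝ) / N) ((i : ℝ) / N) < δ := by
    rw [Real.dist_eq]
    have : ((i + 1 : ℕ) : ℝ) / N - (i : ℝ) / N = 1 / N := by push_cast; ring
    rw [this, abs_of_pos (by positivity), one_div_lt hN1 hδ]
    exact hN2
  have hb := hd _ m2 _ m1 hlt
  have : segment ℝ (ptN γ N i) (ptN γ N (i + 1)) ⊆ Metric.ball (ptN γ N i) ε :=
    (convex_ball _ _).segment_subset (Metric.mem_ball_self hε) hb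
  refine this.trans (subset_trans ?_ hεU)
  exact Metric.ball_subset_thickening (mem_image_of_mem _ m1) ε

namespace MultiDrawing

variable {V E : Type} {ends : E → Sym2 V}

lemma closed_subset (D : MultiDrawing V E ends) {e : E} {p : Plane}
    (hp : p ∈ D.arc e '' Icc (0:ℝ) 1) : p ∈ D.inter e ∨ ∃ u ∈ ends e, p = D.pos u := by
  obtain ⟨t, ht, rfl⟩ := hp
  obtain ⟨u, v, h, h0, h1⟩ := D.arc_ends e
  rcases eq_or_lt_of_le ht.1 with h2 | h2
  · exact Or.inr ⟨u, by simp [h], by rw [← h2, h0]⟩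
  rcases eq_or_lt_of_le ht.2 with h3 | h3
  · exact Or.inr ⟨v, by simp [h], by rw [h3, h1]⟩
  exact Or.inl ⟨t, ⟨h2, h3⟩, rfl⟩

lemma closed_disjoint (D : MultiDrawing V E ends) {e f : E}
    (h : ∀ x, ¬ (x ∈ ends e ∧ x ∈ ends f)) (hd : Disjoint (D.inter e) (D.inter f)) :
    Disjoint (D.arc e '' Icc (0:ℝ) 1) (D.arc f '' Icc (0:ℝ) 1) := by
  rw [Set.disjoint_left]
  intro p hp hq
  rcases D.closed_subset hp with h1 | ⟨u, hu, rfl⟩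
  · rcases D.closed_subset hq with h2 | ⟨w, hw, rfl⟩
    · exact Set.disjoint_left.1 hd h1 h2
    · exact D.arc_avoid e w h1
  · rcases D.closed_subset hq with h2 | ⟨w, hw, h3⟩
    · exact D.arc_avoid f u h2
    · rw [D.pos_inj h3] at hu
      exact h w ⟨hu, hw⟩

lemma pos_not_closed (D : MultiDrawing V E ends) {e : E} {w : V} (h : w ∉ ends e) :
    D.pos w ∉ D.arc e '' Icc (0:ℝ) 1 := by
  intro hp
  rcases D.closed_subset hp with h1 | ⟨u, hu, h3⟩
  · exact D.arc_avoid e w h1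
  · rw [D.pos_inj h3] at h; exact h hu

/-- The parity theorem: non-crossing independent edges have even formal crossing number. -/
theorem parity [Finite V] [Finite E] (D : MultiDrawing V E ends) :
    ∃ (c : E → V → ZMod 2) (τ : V → V → ZMod 2),
      (∀ u v, u ≠ v → τ u v + τ v u = 1) ∧
      ∀ e f u v w z, ends e = s(u, v) → ends f = s(w, z) →
        u ≠ w → u ≠ z → v ≠ w → v ≠ z → Disjoint (D.inter e) (D.inter f) →
        c e w + c e z + c f u + c f v + τ u w + τ u z + τ v w + τ v z = 0 := by
  have ev1 : ∀ᶠ N : ℕ in Filter.atTop, ∀ e f,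
      Disjoint (D.arc e '' Icc (0:ℝ) 1) (D.arc f '' Icc (0:ℝ) 1) →
      ∀ i < N, ∀ j < N,
        Disjoint (segment ℝ (ptN (D.arc e) N i) (ptN (D.arc e) N (i + 1)))
          (segment ℝ (ptN (D.arc f) N j) (ptN (D.arc f) N (j + 1))) := by
    rw [Filter.eventually_all]
    intro e
    rw [Filter.eventually_all]
    intro f
    by_cases h : Disjoint (D.arc e '' Icc (0:ℝ) 1) (D.arc f '' Icc (0:ℝ) 1)
    swap
    · exact Filter.Eventually.of_forall fun N h' => absurd h' h
    obtain ⟨U, W, hU, hW, h1, h2, h3⟩ := SeparatedNhds.of_isCompact_isCompact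
      (isCompact_Icc.image_of_continuousOn (D.arc_cont e))
      (isCompact_Icc.image_of_continuousOn (D.arc_cont f)) h
    filter_upwards [seg_sub_open (D.arc_cont e) hU h1, seg_sub_open (D.arc_cont f) hW h2]
      with N a b _ i hi j hj
    exact h3.mono (a i hi) (b j hj)
  have ev2 : ∀ᶠ N : ℕ in Filter.atTop, ∀ e w, w ∉ ends e →
      ∀ i < N, D.pos w ∉ segment ℝ (ptN (D.arc e) N i) (ptN (D.arc e) N (i + 1)) := by
    rw [Filter.eventually_all]
    intro e
    rw [Filter.eventually_all]
    intro w
    by_cases h : w ∈ ends e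
    · exact Filter.Eventually.of_forall fun N h' => absurd h h'
    have : D.arc e '' Icc (0:ℝ) 1 ⊆ {D.pos w}ᶜ := by
      intro p hp hp'
      rw [mem_singleton_iff.1 hp'] at hp
      exact D.pos_not_closed h hp
    filter_upwards [seg_sub_open (D.arc_cont e) isOpen_compl_singleton this] with N a _ i hi hm
    exact a i hi hm rfl
  obtain ⟨N, hN1, hN2, hN⟩ := (ev1.and (ev2.and (Filter.eventually_ge_atTop 1))).exists
  have hN0 : (N : ℝ) ≠ 0 := by
    have : N ≠ 0 := by omega
    exact_mod_cast this
  have p0 : ∀ e, ptN (D.arc e) N 0 = D.arc e 0 := by intro e; simp [ptN]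
  have p1 : ∀ e, ptN (D.arc e) N N = D.arc e 1 := by intro e; simp [ptN, hN0]
  refine ⟨fun e w => cB (D.arc e) N (D.pos w), fun u v => tau (D.pos u) (D.pos v),
    fun u v h => tau_anti (fun h' => h (D.pos_inj h')), ?_⟩
  have main : ∀ e f u v w z, ends e = s(u, v) → ends f = s(w, z) →
      D.arc e 0 = D.pos u → D.arc e 1 = D.pos v → D.arc f 0 = D.pos w → D.arc f 1 = D.pos z →
        u ≠ w → u ≠ z → v ≠ w → v ≠ z → Disjoint (D.inter e) (D.inter f) →
        cB (D.arc e) N (D.pos w) + cB (D.arc e) N (D.pos z) + cB (D.arc f) N (D.pos u)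
          + cB (D.arc f) N (D.pos v) + tau (D.pos u) (D.pos w) + tau (D.pos u) (D.pos z)
          + tau (D.pos v) (D.pos w) + tau (D.pos v) (D.pos z) = 0 := by
    intro e f u v w z he hf e0 e1 f0 f1 uw uz vw vz hd
    have hcd := D.closed_disjoint (e := e) (f := f) (by
      rintro x ⟨hx, hx'⟩
      rw [he, Sym2.mem_iff] at hx
      rw [hf, Sym2.mem_iff] at hx'
      rcases hx with rfl | rfl <;> rcases hx' with rfl | rfl <;> contradiction) hd
    have h1 := poly_parity (hN1 e f hcd)
    have h2 := cB_add_cA (hN2 f u (by rw [hf, Sym2.mem_iff]; tauto))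
    have h3 := cB_add_cA (hN2 f v (by rw [hf, Sym2.mem_iff]; tauto))
    rw [p0, p1, p0, p1, e0, e1, f0, f1] at h1
    rw [p0, p1, f0, f1] at h2 h3
    have s1 := zmod2_self (cB (D.arc f) N (D.pos u))
    have s2 := zmod2_self (cB (D.arc f) N (D.pos v))
    have s3 := zmod2_self (cA (D.arc f) N (D.pos u))
    have s4 := zmod2_self (cA (D.arc f) N (D.pos v))
    linear_combination h1 - h2 - h3 + s1 + s2
  intro e f u v w z he hf uw uz vw vz hd
  obtain ⟨u', v', he', e0, e1⟩ := D.arc_ends e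
  obtain ⟨w', z', hf', f0, f1⟩ := D.arc_ends f
  have q1 := he.symm.trans he'
  have q2 := hf.symm.trans hf'
  rw [Sym2.eq_iff] at q1 q2
  rcases q1 with ⟨rfl, rfl⟩ | ⟨rfl, rfl⟩ <;> rcases q2 with ⟨rfl, rfl⟩ | ⟨rfl, rfl⟩
  · exact main e f _ _ _ _ he hf e0 e1 f0 f1 uw uz vw vz hd
  · have := main e f _ _ _ _ he hf' e0 e1 f0 f1 uz uw vz vw hd
    linear_combination this
  · have := main e f _ _ _ _ he' hf e0 e1 f0 f1 vw vz uw uz hd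
    linear_combination this
  · have := main e f _ _ _ _ he' hf' e0 e1 f0 f1 vz vw uz uw hd
    linear_combination this

end MultiDrawing

/-! ### Part 2: rigidity of the core -/

section Rigid

variable {V : Type}

/-- Formal crossing parity of the edges `uv` and `wz`. -/
def XX (cc : V → V → V → ZMod 2) (τ : V → V → ZMod 2) (u v w z : V) : ZMod 2 :=
  cc u v w + cc u v z + cc w z u + cc w z v + τ u w + τ u z + τ v w + τ v z

/-- Combinatorial shadow of a 1-planar drawing. -/
structure IsPar (H : SimpleGraph V) (cc : V → V → V → ZMod 2) (τ : V → V → ZMod 2) : Prop where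
  symm : ∀ u v w, cc u v w = cc v u w
  anti : ∀ u v, u ≠ v → τ u v + τ v u = 1
  mtch : ∀ u v w z w' z', H.Adj u v → H.Adj w z → H.Adj w' z' →
    u ≠ w → u ≠ z → v ≠ w → v ≠ z → u ≠ w' → u ≠ z' → v ≠ w' → v ≠ z' →
    XX cc τ u v w z ≠ 0 → XX cc τ u v w' z' ≠ 0 → s(w, z) = s(w', z')

theorem exists_isPar [Finite V] {H : SimpleGraph V} (h : H.IsOnePlanar) :
    ∃ cc τ, IsPar H cc τ := by
  classical
  obtain ⟨D, hD⟩ := h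
  obtain ⟨c, τ, h1, h2⟩ := D.parity
  refine ⟨fun u v w => if huv : H.Adj u v then c ⟨s(u, v), huv⟩ w else 0, τ, ?_, h1, ?_⟩
  · intro u v w
    by_cases huv : H.Adj u v
    · have hvu := huv.symm
      simp only [huv, hvu, dif_pos]
      congr 2
      exact Sym2.eq_swap
    · have hvu : ¬ H.Adj v u := fun h => huv h.symm
      simp only [huv, hvu, dif_neg, not_false_eq_true]
  · intro u v w z w' z' huv hwz hwz' a1 a2 a3 a4 b1 b2 b3 b4 hx hx'
    simp only [XX, huv, hwz, hwz', dif_pos] at hx hx'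
    have n1 : ¬ Disjoint (D.inter ⟨s(u, v), huv⟩) (D.inter ⟨s(w, z), hwz⟩) := fun hd =>
      hx (h2 _ _ _ _ _ _ rfl rfl a1 a2 a3 a4 hd)
    have n2 : ¬ Disjoint (D.inter ⟨s(u, v), huv⟩) (D.inter ⟨s(w', z'), hwz'⟩) := fun hd =>
      hx' (h2 _ _ _ _ _ _ rfl rfl b1 b2 b3 b4 hd)
    rw [Set.not_disjoint_iff] at n1 n2
    obtain ⟨p, hp, hp'⟩ := n1
    obtain ⟨q, hq, hq'⟩ := n2
    have m1 : ((⟨s(w, z), hwz⟩, p) : H.edgeSet × Plane) ∈ D.crossSet ⟨s(u, v), huv⟩ := by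
      refine ⟨?_, hp, hp'⟩
      intro h
      have := congrArg Subtype.val h
      simp only [Sym2.eq_iff] at this
      rcases this with ⟨h, -⟩ | ⟨h, -⟩
      · exact a1 h.symm
      · exact a3 h.symm
    have m2 : ((⟨s(w', z'), hwz'⟩, q) : H.edgeSet × Plane) ∈ D.crossSet ⟨s(u, v), huv⟩ := by
      refine ⟨?_, hq, hq'⟩
      intro h
      have := congrArg Subtype.val h
      simp only [Sym2.eq_iff] at this
      rcases this with ⟨h, -⟩ | ⟨h, -⟩
      · exact b1 h.symm
      · exact b3 h.symm
    have := hD _ m1 m2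
    exact congrArg (fun x => ((x.1 : H.edgeSet) : Sym2 V)) this

lemma two_zmod2 : (2 : ZMod 2) = 0 := rfl

lemma tri_identity (cc : V → V → V → ZMod 2) (τ : V → V → ZMod 2) (a b c d e f : V) :
    XX cc τ a b d e + XX cc τ a b d f + XX cc τ a b e f + XX cc τ a c d e + XX cc τ a c d f +
    XX cc τ a c e f + XX cc τ b c d e + XX cc τ b c d f + XX cc τ b c e f = 0 := by
  unfold XX
  linear_combination (
    1 * cc a b d + 1 * cc a b e + 1 * cc a b f + 1 * cc a c d + 1 * cc a c e + 1 * cc a c f + 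
    1 * cc b c d + 1 * cc b c e + 1 * cc b c f + 1 * cc d e a + 1 * cc d e b + 1 * cc d e c + 
    1 * cc d f a + 1 * cc d f b + 1 * cc d f c + 1 * cc e f a + 1 * cc e f b + 1 * cc e f c + 
    2 * τ a d + 2 * τ a e + 2 * τ a f + 2 * τ b d + 2 * τ b e + 2 * τ b f + 2 * τ c d + 
    2 * τ c e + 2 * τ c f) * two_zmod2

lemma k33_identity (cc : V → V → V → ZMod 2) (τ : V → V → ZMod 2) (a b c d e f : V)
    (h1 : τ d e + τ e d = 1) (h2 : τ d f + τ f d = 1) (h3 : τ e f + τ f e = 1) :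
    XX cc τ a d b e + XX cc τ a d b f + XX cc τ a e b d + XX cc τ a e b f + XX cc τ a f b d +
    XX cc τ a f b e + XX cc τ a d c e + XX cc τ a d c f + XX cc τ a e c d + XX cc τ a e c f +
    XX cc τ a f c d + XX cc τ a f c e + XX cc τ b d c e + XX cc τ b d c f + XX cc τ b e c d +
    XX cc τ b e c f + XX cc τ b f c d + XX cc τ b f c e = 1 := by
  unfold XX
  linear_combination (4 +
    1 * cc a d b + 1 * cc a d c + 1 * cc a d e + 1 * cc a d f + 1 * cc a e b + 1 * cc a e c + 
    1 * cc a e d + 1 * cc a e f + 1 * cc a f b + 1 * cc a f c + 1 * cc a f d + 1 * cc a f e + 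
    1 * cc b d a + 1 * cc b d c + 1 * cc b d e + 1 * cc b d f + 1 * cc b e a + 1 * cc b e c + 
    1 * cc b e d + 1 * cc b e f + 1 * cc b f a + 1 * cc b f c + 1 * cc b f d + 1 * cc b f e + 
    1 * cc c d a + 1 * cc c d b + 1 * cc c d e + 1 * cc c d f + 1 * cc c e a + 1 * cc c e b + 
    1 * cc c e d + 1 * cc c e f + 1 * cc c f a + 1 * cc c f b + 1 * cc c f d + 1 * cc c f e + 
    3 * τ a b + 3 * τ a c + 2 * τ a d + 2 * τ a e + 2 * τ a f + 3 * τ b c + 1 * τ b d + 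
    1 * τ b e + 1 * τ b f + 1 * τ d b + 2 * τ d c + 1 * τ e b + 2 * τ e c + 1 * τ f b + 
    2 * τ f c) * two_zmod2 + 3 * h1 + 3 * h2 + 3 * h3

variable {H : SimpleGraph V} {cc : V → V → V → ZMod 2} {τ : V → V → ZMod 2}

lemma XX_symm (hP : IsPar H cc τ) {u v w z : V} (a1 : u ≠ w) (a2 : u ≠ z) (a3 : v ≠ w)
    (a4 : v ≠ z) : XX cc τ w z u v = XX cc τ u v w z := by
  have h1 := hP.anti _ _ a1
  have h2 := hP.anti _ _ a2
  have h3 := hP.anti _ _ a3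
  have h4 := hP.anti _ _ a4
  unfold XX
  linear_combination h1 + h2 + h3 + h4 +
    (2 - τ u w - τ u z - τ v w - τ v z) * two_zmod2

lemma XX_swapl (hP : IsPar H cc τ) (u v w z : V) : XX cc τ v u w z = XX cc τ u v w z := by
  unfold XX
  rw [hP.symm v u w, hP.symm v u z]
  ring

lemma XX_swapr (hP : IsPar H cc τ) (u v w z : V) : XX cc τ u v z w = XX cc τ u v w z := by
  unfold XX
  rw [hP.symm z w u, hP.symm z w v]
  ring

/-- Adjacency in the core `K_(2,2,2,2)`. -/
def cadj (a b : Fin 8) : Bool := a != b && a != b + 4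

/-- The code of a pair of core edges. -/
def nk (a b c d : Fin 8) : ℕ :=
  let e := min a.val b.val * 8 + max a.val b.val
  let f := min c.val d.val * 8 + max c.val d.val
  min e f * 64 + max e f

/-- Last octal digit. -/
def dg (n : ℕ) : Fin 8 := ⟨n % 8, Nat.mod_lt _ (by norm_num)⟩

/-- Value of the crossing parity on coded edges. -/
def xe (cc : V → V → V → ZMod 2) (τ : V → V → ZMod 2) (κ : Fin 8 → V) (e f : ℕ) : ZMod 2 :=
  XX cc τ (κ (dg (e / 8))) (κ (dg e)) (κ (dg (f / 8))) (κ (dg f))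

/-- Value of the crossing parity on coded pairs. -/
def xk (cc : V → V → V → ZMod 2) (τ : V → V → ZMod 2) (κ : Fin 8 → V) (k : ℕ) : ZMod 2 :=
  xe cc τ κ (k / 64) (k % 64)

/-- Independence of four vertices as two edges. -/
def ind4 (a b c d : Fin 8) : Bool := a != c && a != d && b != c && b != d

lemma nk_digits : ∀ a b c d : Fin 8,
    let k := nk a b c d
    (((dg (k / 64 / 8) = a ∧ dg (k / 64) = b) ∨ (dg (k / 64 / 8) = b ∧ dg (k / 64) = a)) ∧
     ((dg (k % 64 / 8) = c ∧ dg (k % 64) = d) ∨ (dg (k % 64 / 8) = d ∧ dg (k % 64) = c))) ∨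
    (((dg (k / 64 / 8) = c ∧ dg (k / 64) = d) ∨ (dg (k / 64 / 8) = d ∧ dg (k / 64) = c)) ∧
     ((dg (k % 64 / 8) = a ∧ dg (k % 64) = b) ∨ (dg (k % 64 / 8) = b ∧ dg (k % 64) = a))) := by
  decide +kernel

lemma xk_nk (hP : IsPar H cc τ) {κ : Fin 8 → V} (hκ : Function.Injective κ) {a b c d : Fin 8}
    (h : ind4 a b c d = true) : xk cc τ κ (nk a b c d) = XX cc τ (κ a) (κ b) (κ c) (κ d) := by
  simp only [ind4, Bool.and_eq_true, bne_iff_ne, ne_eq] at h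
  obtain ⟨⟨⟨h1, h2⟩, h3⟩, h4⟩ := h
  have g1 : κ a ≠ κ c := fun h => h1 (hκ h)
  have g2 : κ a ≠ κ d := fun h => h2 (hκ h)
  have g3 : κ b ≠ κ c := fun h => h3 (hκ h)
  have g4 : κ b ≠ κ d := fun h => h4 (hκ h)
  have := nk_digits a b c d
  simp only at this
  unfold xk xe
  rcases this with ⟨⟨e1, e2⟩ | ⟨e1, e2⟩, ⟨e3, e4⟩ | ⟨e3, e4⟩⟩ |
      ⟨⟨e1, e2⟩ | ⟨e1, e2⟩, ⟨e3, e4⟩ | ⟨e3, e4⟩⟩ <;> rw [e1, e2, e3, e4]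
  · rw [XX_swapr hP]
  · rw [XX_swapl hP]
  · rw [XX_swapl hP, XX_swapr hP]
  · rw [XX_symm hP g1 g2 g3 g4]
  · rw [XX_swapr hP, XX_symm hP g1 g2 g3 g4]
  · rw [XX_swapl hP, XX_symm hP g1 g2 g3 g4]
  · rw [XX_swapl hP, XX_swapr hP, XX_symm hP g1 g2 g3 g4]

/-- The keys of a constraint. -/
def conKeys (n : ℕ) : List ℕ :=
  let a := dg (n / 32768)
  let b := dg (n / 4096)
  let c := dg (n / 512)
  let d := dg (n / 64)
  let e := dg (n / 8)
  let f := dg n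
  if n < 262144 then
    [nk a b d e, nk a b d f, nk a b e f, nk a c d e, nk a c d f, nk a c e f, nk b c d e,
    nk b c d f, nk b c e f]
  else
    [nk a d b e, nk a d b f, nk a e b d, nk a e b f, nk a f b d, nk a f b e, nk a d c e,
    nk a d c f, nk a e c d, nk a e c f, nk a f c d, nk a f c e, nk b d c e, nk b d c f,
    nk b e c d, nk b e c f, nk b f c d, nk b f c e]

/-- The parity of a constraint. -/
def conPar (n : ℕ) : ℕ := if n < 262144 then 0 else 1

/-- The six vertices of a constraint are distinct. -/
def conOK (n : ℕ) : Bool :=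
  let a := dg (n / 32768)
  let b := dg (n / 4096)
  let c := dg (n / 512)
  let d := dg (n / 64)
  let e := dg (n / 8)
  let f := dg n
  a != b && a != c && b != c && d != e && d != f && e != f && a != d && a != e && a != f &&
  b != d && b != e && b != f && c != d && c != e && c != f

lemma con_sum (hP : IsPar H cc τ) {κ : Fin 8 → V} (hκ : Function.Injective κ) {n : ℕ}
    (h : conOK n = true) : ((conKeys n).map (xk cc τ κ)).sum = (conPar n : ZMod 2) := by
  unfold conKeys conPar
  unfold conOK at h
  simp only at h ⊢
  generalize dg (n / 32768) = a at *
  generalize dg (n / 4096) = b at *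
  generalize dg (n / 512) = c at *
  generalize dg (n / 64) = d at *
  generalize dg (n / 8) = e at *
  generalize dg n = f at *
  simp only [Bool.and_eq_true, bne_iff_ne, ne_eq] at h
  obtain ⟨⟨⟨⟨⟨⟨⟨⟨⟨⟨⟨⟨⟨⟨a1, a2⟩, a3⟩, a4⟩, a5⟩, a6⟩, a7⟩, a8⟩, a9⟩, a10⟩, a11⟩, a12⟩, a13⟩, a14⟩, a15⟩ := h
  have X : ∀ p q r s : Fin 8, p ≠ r → p ≠ s → q ≠ r → q ≠ s →
      xk cc τ κ (nk p q r s) = XX cc τ (κ p) (κ q) (κ r) (κ s) := by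
    intro p q r s h1 h2 h3 h4
    exact xk_nk hP hκ (by simp [ind4, h1, h2, h3, h4])
  split_ifs with hn
  · simp only [List.map_cons, List.map_nil, List.sum_cons, List.sum_nil]
    rw [X _ _ _ _ ‹_› ‹_› ‹_› ‹_›, X _ _ _ _ ‹_› ‹_› ‹_› ‹_›, X _ _ _ _ ‹_› ‹_› ‹_› ‹_›,
    X _ _ _ _ ‹_› ‹_› ‹_› ‹_›, X _ _ _ _ ‹_› ‹_› ‹_› ‹_›, X _ _ _ _ ‹_› ‹_› ‹_› ‹_›,
    X _ _ _ _ ‹_› ‹_› ‹_› ‹_›, X _ _ _ _ ‹_› ‹_› ‹_› ‹_›, X _ _ _ _ ‹_› ‹_› ‹_› ‹_›]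
    rw [Nat.cast_zero]
    linear_combination tri_identity cc τ (κ a) (κ b) (κ c) (κ d) (κ e) (κ f)
  · simp only [List.map_cons, List.map_nil, List.sum_cons, List.sum_nil]
    have b1 := Ne.symm a1
    have b2 := Ne.symm a2
    have b3 := Ne.symm a3
    have b4 := Ne.symm a4
    have b5 := Ne.symm a5
    have b6 := Ne.symm a6
    have b7 := Ne.symm a7
    have b8 := Ne.symm a8
    have b9 := Ne.symm a9
    have b10 := Ne.symm a10
    have b11 := Ne.symm a11
    have b12 := Ne.symm a12
    have b13 := Ne.symm a13
    have b14 := Ne.symm a14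
    have b15 := Ne.symm a15
    rw [X _ _ _ _ ‹_› ‹_› ‹_› ‹_›, X _ _ _ _ ‹_› ‹_› ‹_› ‹_›, X _ _ _ _ ‹_› ‹_› ‹_› ‹_›,
    X _ _ _ _ ‹_› ‹_› ‹_› ‹_›, X _ _ _ _ ‹_› ‹_› ‹_› ‹_›, X _ _ _ _ ‹_› ‹_› ‹_› ‹_›,
    X _ _ _ _ ‹_› ‹_› ‹_› ‹_›, X _ _ _ _ ‹_› ‹_› ‹_› ‹_›, X _ _ _ _ ‹_› ‹_› ‹_› ‹_›,
    X _ _ _ _ ‹_› ‹_› ‹_› ‹_›, X _ _ _ _ ‹_› ‹_› ‹_› ‹_›, X _ _ _ _ ‹_› ‹_› ‹_› ‹_›,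
    X _ _ _ _ ‹_› ‹_› ‹_› ‹_›, X _ _ _ _ ‹_› ‹_› ‹_› ‹_›, X _ _ _ _ ‹_› ‹_› ‹_› ‹_›,
    X _ _ _ _ ‹_› ‹_› ‹_› ‹_›, X _ _ _ _ ‹_› ‹_› ‹_› ‹_›, X _ _ _ _ ‹_› ‹_› ‹_› ‹_›]
    rw [Nat.cast_one, ← k33_identity cc τ (κ a) (κ b) (κ c) (κ d) (κ e) (κ f)
      (hP.anti _ _ fun h => a4 (hκ h)) (hP.anti _ _ fun h => a5 (hκ h))
      (hP.anti _ _ fun h => a6 (hκ h))]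
    ring


/-- Validity of an edge code. -/
def vE (e : ℕ) : Bool := decide (e < 64) && decide (e / 8 < e % 8) && cadj (dg (e / 8)) (dg e)

/-- Independence of edge codes. -/
def indE (e f : ℕ) : Bool := ind4 (dg (e / 8)) (dg e) (dg (f / 8)) (dg f)

/-- `e` cannot cross both `f` and `g`. -/
def conf4 (e f g : ℕ) : Bool := vE e && vE f && vE g && indE e f && indE e g && f != g

/-- Conflicting pairs. -/
def conf (k l : ℕ) : Bool :=
  let a := k / 64
  let b := k % 64
  let c := l / 64
  let d := l % 64
  (a == c && conf4 a b d) || (a == d && conf4 a b c) ||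
  (b == c && conf4 b a d) || (b == d && conf4 b a c)

variable {κ : Fin 8 → V}

lemma indE_ne (hκ : Function.Injective κ) {e f : ℕ} (h : indE e f = true) :
    κ (dg (e / 8)) ≠ κ (dg (f / 8)) ∧ κ (dg (e / 8)) ≠ κ (dg f) ∧
    κ (dg e) ≠ κ (dg (f / 8)) ∧ κ (dg e) ≠ κ (dg f) := by
  simp only [indE, ind4, Bool.and_eq_true, bne_iff_ne, ne_eq] at h
  obtain ⟨⟨⟨h1, h2⟩, h3⟩, h4⟩ := h
  exact ⟨fun h => h1 (hκ h), fun h => h2 (hκ h), fun h => h3 (hκ h), fun h => h4 (hκ h)⟩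

lemma xe_symm (hP : IsPar H cc τ) (hκ : Function.Injective κ) {e f : ℕ} (h : indE e f = true) :
    xe cc τ κ f e = xe cc τ κ e f := by
  obtain ⟨h1, h2, h3, h4⟩ := indE_ne hκ h
  exact XX_symm hP h1 h2 h3 h4

lemma conf4_sound (hP : IsPar H cc τ) (hκ : Function.Injective κ)
    (hadj : ∀ a b, cadj a b = true → H.Adj (κ a) (κ b)) {e f g : ℕ} (h : conf4 e f g = true)
    (h1 : xe cc τ κ e f ≠ 0) (h2 : xe cc τ κ e g ≠ 0) : False := by
  simp only [conf4, vE, Bool.and_eq_true, bne_iff_ne, ne_eq, decide_eq_true_eq] at h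
  obtain ⟨⟨⟨⟨⟨⟨⟨e1, e2⟩, e3⟩, ⟨⟨f1, f2⟩, f3⟩⟩, ⟨⟨g1, g2⟩, g3⟩⟩, i1⟩, i2⟩, hne⟩ := h
  obtain ⟨a1, a2, a3, a4⟩ := indE_ne hκ i1
  obtain ⟨b1, b2, b3, b4⟩ := indE_ne hκ i2
  have := hP.mtch _ _ _ _ _ _ (hadj _ _ e3) (hadj _ _ f3) (hadj _ _ g3) a1 a2 a3 a4 b1 b2 b3 b4 h1 h2
  rw [Sym2.eq_iff] at this
  rcases this with ⟨p, q⟩ | ⟨p, q⟩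
  · have p := congrArg Fin.val (hκ p)
    have q := congrArg Fin.val (hκ q)
    simp only [dg] at p q
    rw [Nat.mod_eq_of_lt (show f / 8 < 8 by omega)] at p
    rw [Nat.mod_eq_of_lt (show g / 8 < 8 by omega)] at *
    omega
  · have p := congrArg Fin.val (hκ p)
    have q := congrArg Fin.val (hκ q)
    simp only [dg] at p q
    rw [Nat.mod_eq_of_lt (show f / 8 < 8 by omega)] at p
    rw [Nat.mod_eq_of_lt (show g / 8 < 8 by omega)] at *
    omega

lemma conf4_ind {e f g : ℕ} (h : conf4 e f g = true) : indE e f = true ∧ indE e g = true := by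
  simp only [conf4, Bool.and_eq_true] at h
  tauto

lemma conf_sound (hP : IsPar H cc τ) (hκ : Function.Injective κ)
    (hadj : ∀ a b, cadj a b = true → H.Adj (κ a) (κ b)) {k l : ℕ} (h : conf k l = true)
    (h1 : xk cc τ κ k ≠ 0) (h2 : xk cc τ κ l ≠ 0) : False := by
  simp only [conf, Bool.or_eq_true, Bool.and_eq_true, beq_iff_eq] at h
  unfold xk at h1 h2
  rcases h with ((⟨e, h⟩ | ⟨e, h⟩) | ⟨e, h⟩) | ⟨e, h⟩
  · rw [← e] at h2
    exact conf4_sound hP hκ hadj h h1 h2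
  · rw [← e, xe_symm hP hκ (conf4_ind h).2] at h2
    exact conf4_sound hP hκ hadj h h1 h2
  · rw [← e] at h2
    rw [xe_symm hP hκ (conf4_ind h).1] at h1
    exact conf4_sound hP hκ hadj h h1 h2
  · rw [← e, xe_symm hP hκ (conf4_ind h).2] at h2
    rw [xe_symm hP hκ (conf4_ind h).1] at h1
    exact conf4_sound hP hκ hadj h h1 h2

/-- Options for satisfying a constraint. -/
def opts (n : ℕ) (cur exc : List ℕ) : List ℕ :=
  (conKeys n).filter fun k => !cur.contains k && !exc.contains k && !cur.any (conf k)

/-- The constraint is violated by the current set. -/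
def viol (n : ℕ) (cur : List ℕ) : Bool :=
  ((conKeys n).filter fun k => cur.contains k).length % 2 != conPar n

/-- Relabelings of the standard cube. -/
def sig (i : ℕ) (a : Fin 8) : Fin 8 :=
  dg ((([16303784, 7917224, 15255464, 6868904, 15386504, 6999944, 8048264, 16434824] :
    List ℕ).getD i 0) / 8 ^ a.val)

/-- The six crossings of the standard cube. -/
def stdq : List (Fin 8 × Fin 8 × Fin 8 × Fin 8) :=
  [(0, 7, 1, 2), (0, 6, 1, 3), (2, 4, 7, 5), (3, 4, 6, 5), (0, 5, 2, 3), (1, 4, 7, 6)]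

/-- The keys of a relabeled cube. -/
def cubeKeys (i : ℕ) : List ℕ :=
  stdq.map fun q => nk (sig i q.1) (sig i q.2.1) (sig i q.2.2.1) (sig i q.2.2.2)

/-- Case-analysis certificates. -/
inductive Tr where
  | cube (i : ℕ)
  | con (n : ℕ) (t : Tr)
  | opt (t₁ t₂ : Tr)
  | done

/-- The certificate checker. -/
def chk : Tr → List ℕ → List ℕ → Option (List ℕ) → Bool
  | .cube i, cur, _, none => decide (i < 8) && (cubeKeys i).all cur.contains
  | .con n t, cur, exc, none => conOK n && viol n cur && chk t cur exc (some (opts n cur exc))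
  | .opt t₁ t₂, cur, exc, some (o :: os) => chk t₁ (o :: cur) exc none && chk t₂ cur (o :: exc) (some os)
  | .done, _, _, some [] => true
  | _, _, _, _ => false

/-- The certificate. -/
def cert : Tr :=
  (.con 268446 (.opt (.con 10844 (.opt (.con 10846 (.opt (.con 10855 .done) (.opt (.con 10854
  .done) .done))) (.opt (.con 10846 (.opt (.con 10854 .done) (.opt (.con 11868 (.opt (.con 23644
  .done) (.opt (.con 23644 .done) .done))) .done))) (.opt (.con 10846 (.opt (.con 10855 .done)
  (.opt (.con 10854 .done) .done))) (.opt (.con 10846 (.opt (.con 10854 .done) (.opt (.con 11868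
  (.opt (.con 24156 .done) (.opt (.con 11870 (.opt (.con 24166 (.opt (.cube 4) .done)) .done))
  .done))) .done))) .done))))) (.opt (.con 9830 (.opt (.con 9831 (.opt (.con 10854 (.opt (.con
  11878 .done) (.opt (.con 11878 .done) .done))) (.opt (.con 9847 .done) .done))) (.opt (.con 9847
  (.opt (.con 9831 .done) (.opt (.con 10030 .done) .done))) (.opt (.con 9831 (.opt (.con 10854
  (.opt (.con 11878 .done) (.opt (.con 11878 .done) .done))) (.opt (.con 9847 .done) .done)))
  (.opt (.con 9847 (.opt (.con 9831 .done) (.opt (.con 10030 .done) .done))) .done))))) (.opt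
  (.con 14932 (.opt (.con 14935 (.opt (.con 14950 .done) (.opt (.con 14950 .done) .done))) (.opt
  (.con 14935 (.opt (.con 14951 .done) (.opt (.con 15444 (.opt (.con 24148 .done) (.opt (.con
  23636 .done) .done))) .done))) (.opt (.con 14935 (.opt (.con 14950 .done) (.opt (.con 14950
  .done) .done))) (.opt (.con 14935 (.opt (.con 14951 .done) (.opt (.con 15444 (.opt (.con 23636
  .done) (.opt (.con 15447 (.opt (.con 23655 (.opt (.cube 6) .done)) .done)) .done))) .done)))
  .done))))) (.opt (.con 9830 (.opt (.con 9831 (.opt (.con 10854 (.opt (.con 11878 .done) (.opt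
  (.con 11878 .done) .done))) (.opt (.con 9847 .done) .done))) (.opt (.con 9847 (.opt (.con 9831
  .done) (.opt (.con 10030 .done) .done))) (.opt (.con 9831 (.opt (.con 10855 (.opt (.con 14951
  .done) (.opt (.con 10871 (.opt (.con 14950 (.opt (.cube 5) .done)) .done)) .done))) (.opt (.con
  9847 .done) .done))) (.opt (.con 9847 (.opt (.con 9831 .done) (.opt (.con 10030 .done) .done)))
  .done))))) (.opt (.con 15444 (.opt (.con 14932 (.opt (.con 24148 .done) (.opt (.con 23636 .done)
  .done))) (.opt (.con 14932 (.opt (.con 24148 .done) (.opt (.con 23636 .done) .done))) (.opt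
  (.con 15447 (.opt (.con 9831 (.opt (.con 10855 .done) (.opt (.con 14951 .done) .done))) (.opt
  (.con 15463 .done) .done))) (.opt (.con 15447 (.opt (.con 15463 .done) (.opt (.con 15525 .done)
  .done))) .done))))) (.opt (.con 23635 (.opt (.con 23636 (.opt (.con 23639 .done) (.opt (.con
  23639 .done) .done))) (.opt (.con 23644 (.opt (.con 23636 .done) (.opt (.con 24147 (.opt (.con
  24220 (.opt (.con 28244 (.opt (.cube 7) .done)) .done)) (.opt (.con 28243 .done) .done)))
  .done))) (.opt (.con 23636 (.opt (.con 23639 .done) (.opt (.con 23639 .done) .done))) (.opt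
  (.con 23644 (.opt (.con 23636 .done) (.opt (.con 10844 (.opt (.con 11868 .done) (.opt (.con
  24156 .done) .done))) .done))) .done))))) (.opt (.con 5349 (.opt (.con 5350 (.opt (.con 7397
  (.opt (.con 7909 .done) (.opt (.con 7909 .done) .done))) (.opt (.con 5358 .done) .done))) (.opt
  (.con 5350 (.opt (.con 5358 .done) (.opt (.con 5423 .done) .done))) (.opt (.con 5350 (.opt (.con
  7910 (.opt (.con 10982 .done) (.opt (.con 10982 .done) .done))) (.opt (.con 5358 .done) .done)))
  (.opt (.con 5350 (.opt (.con 5358 .done) (.opt (.con 5423 .done) .done))) .done))))) (.opt (.con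
  9830 (.opt (.con 9831 (.opt (.con 9847 .done) (.opt (.con 10030 .done) .done))) (.opt (.con 9831
  (.opt (.con 9847 .done) (.opt (.con 10030 .done) .done))) (.opt (.con 9847 (.opt (.con 9831
  .done) (.opt (.con 10030 .done) .done))) .done)))) (.opt (.con 15444 (.opt (.con 14932 (.opt
  (.con 24148 .done) (.opt (.con 23636 .done) .done))) (.opt (.con 5350 (.opt (.con 5349 (.opt
  (.con 14932 (.opt (.con 14950 .done) .done)) (.opt (.con 5358 .done) .done))) (.opt (.con 5358
  (.opt (.con 5349 .done) (.opt (.con 5431 .done) .done))) .done))) (.opt (.con 14932 (.opt (.con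
  23636 .done) (.opt (.con 5358 (.opt (.con 7918 .done) (.opt (.con 12014 .done) .done))) .done)))
  .done)))) (.opt (.con 9830 (.opt (.con 9831 (.opt (.con 9847 .done) (.opt (.con 10030 .done)
  .done))) (.opt (.con 9831 (.opt (.con 9847 .done) (.opt (.con 10030 .done) .done))) (.opt (.con
  9847 (.opt (.con 9831 .done) (.opt (.con 10030 .done) .done))) .done)))) (.opt (.con 15444 (.opt
  (.con 9830 (.opt (.con 7325 (.opt (.con 7335 .done) (.opt (.con 7333 .done) .done))) (.opt (.con
  7324 (.opt (.con 7836 .done) (.opt (.con 14950 .done) .done))) .done))) (.opt (.con 5350 (.opt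
  (.con 5349 (.opt (.con 7397 (.opt (.con 7335 .done) .done)) (.opt (.con 5358 .done) .done)))
  (.opt (.con 5358 (.opt (.con 5349 .done) (.opt (.con 5431 .done) .done))) .done))) (.opt (.con
  15463 (.opt (.con 15447 .done) (.opt (.con 15525 .done) .done))) .done)))) (.opt (.con 7324
  (.opt (.con 7325 (.opt (.con 7333 .done) (.opt (.con 7836 (.opt (.con 23708 .done) (.opt (.con
  23708 .done) .done))) .done))) (.opt (.con 7333 (.opt (.con 7325 .done) (.opt (.con 7335 .done)
  .done))) (.opt (.con 7325 (.opt (.con 7333 .done) (.opt (.con 5349 (.opt (.con 7909 .done) (.opt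
  (.con 7909 .done) .done))) .done))) (.opt (.con 7333 (.opt (.con 7325 .done) (.opt (.con 7335
  .done) .done))) .done))))) (.opt (.con 5350 (.opt (.con 5349 (.opt (.con 7910 (.opt (.con 12006
  .done) (.opt (.con 7918 (.opt (.con 12005 (.opt (.cube 2) .done)) .done)) .done))) (.opt (.con
  5358 .done) .done))) (.opt (.con 5349 (.opt (.con 5358 .done) (.opt (.con 5423 .done) .done)))
  (.opt (.con 5349 (.opt (.con 7397 (.opt (.con 7909 .done) (.opt (.con 7909 .done) .done))) (.opt
  (.con 5358 .done) .done))) .done)))) (.opt (.con 5350 (.opt (.con 5349 (.opt (.con 5358 .done)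
  (.opt (.con 5423 .done) .done))) (.opt (.con 5358 (.opt (.con 5349 .done) (.opt (.con 5431
  .done) .done))) (.opt (.con 5358 (.opt (.con 5349 .done) (.opt (.con 5431 .done) .done)))
  .done)))) (.opt (.con 5797 (.opt (.con 5799 (.opt (.con 7333 (.opt (.con 7845 .done) (.opt (.con
  7845 .done) .done))) (.opt (.con 5807 .done) .done))) (.opt (.con 5934 (.opt (.con 5422 .done)
  .done)) (.opt (.con 5799 (.opt (.con 7335 (.opt (.con 15527 .done) (.opt (.con 7343 (.opt (.con
  15525 (.opt (.cube 1) .done)) .done)) .done))) (.opt (.con 5807 .done) .done))) (.opt (.con 5799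
  (.opt (.con 5807 .done) (.opt (.con 5934 .done) .done))) .done))))) (.opt (.con 5934 (.opt (.con
  5797 (.opt (.con 5807 .done) .done)) (.opt (.con 5422 (.opt (.con 7982 .done) (.opt (.con 7982
  .done) .done))) (.opt (.con 5797 (.opt (.con 5799 .done) (.opt (.con 5807 .done) .done))) (.opt
  (.con 5943 (.opt (.con 5799 .done) (.opt (.con 5431 (.opt (.con 10039 .done) (.opt (.con 5495
  (.opt (.con 10030 (.opt (.cube 3) .done)) .done)) .done))) .done))) .done))))) (.opt (.con 7324
  (.opt (.con 7325 (.opt (.con 7335 .done) (.opt (.con 7333 .done) .done))) (.opt (.con 5350 (.opt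
  (.con 5349 (.opt (.con 7397 (.opt (.con 7335 .done) .done)) (.opt (.con 5358 .done) .done)))
  (.opt (.con 5349 (.opt (.con 7397 (.opt (.con 7335 .done) .done)) (.opt (.con 5358 .done)
  .done))) .done))) (.opt (.con 7325 (.opt (.con 7335 .done) (.opt (.con 7333 .done) .done)))
  .done)))) (.opt (.con 7324 (.opt (.con 7325 (.opt (.con 7333 .done) (.opt (.con 7836 (.opt (.con
  24220 .done) (.opt (.con 7837 (.opt (.con 28325 (.opt (.cube 0) .done)) .done)) .done)))
  .done))) (.opt (.con 7333 (.opt (.con 7325 .done) (.opt (.con 7335 .done) .done))) (.opt (.con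
  7325 (.opt (.con 7333 .done) (.opt (.con 5349 (.opt (.con 7909 .done) (.opt (.con 7909 .done)
  .done))) .done))) .done)))) .done)))))))))))))))))))

lemma chk_cert : chk cert [] [] none = true := by decide +kernel

lemma zmod2_ne {x : ZMod 2} (h : x ≠ 0) : x = 1 := by
  revert x; decide

lemma viol_sound (x : ℕ → ZMod 2) (L cur : List ℕ) (hcur : ∀ k ∈ cur, x k ≠ 0)
    (h : ∀ k ∈ L, k ∉ cur → x k = 0) :
    (L.map x).sum = (((L.filter fun k => cur.contains k).length % 2 : ℕ) : ZMod 2) := by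
  rw [ZMod.natCast_mod]
  induction L with
  | nil => simp
  | cons a L ih =>
    have ih := ih fun k hk => h k (List.mem_cons_of_mem _ hk)
    rw [List.map_cons, List.sum_cons, ih]
    by_cases ha : a ∈ cur
    · have : cur.contains a = true := by simpa using ha
      rw [List.filter_cons_of_pos this, zmod2_ne (hcur a ha), List.length_cons]
      push_cast
      ring
    · have : ¬ cur.contains a = true := by simpa using ha
      rw [List.filter_cons_of_neg this, h a (List.mem_cons_self ..) ha, zero_add]

theorem chk_sound (hP : IsPar H cc τ) (hκ : Function.Injective κ)
    (hadj : ∀ a b, cadj a b = true → H.Adj (κ a) (κ b)) (t : Tr) :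
    ∀ cur exc m, chk t cur exc m = true → (∀ k ∈ cur, xk cc τ κ k ≠ 0) →
      (∀ k ∈ exc, xk cc τ κ k = 0) → (∀ os, m = some os → ∃ o ∈ os, xk cc τ κ o ≠ 0) →
      ∃ i < 8, ∀ k ∈ cubeKeys i, xk cc τ κ k ≠ 0 := by
  induction t with
  | cube i =>
    intro cur exc m h hc he hm
    cases m with
    | some _ => simp [chk] at h
    | none =>
      simp only [chk, Bool.and_eq_true, decide_eq_true_eq, List.all_eq_true] at h
      refine ⟨i, h.1, fun k hk => hc k ?_⟩
      simpa using h.2 k hk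
  | con n t ih =>
    intro cur exc m h hc he hm
    cases m with
    | some _ => simp [chk] at h
    | none =>
      simp only [chk, Bool.and_eq_true] at h
      obtain ⟨⟨h1, h2⟩, h3⟩ := h
      refine ih _ _ _ h3 hc he ?_
      rintro os hos
      rw [Option.some_inj] at hos
      subst hos
      have : ∃ k ∈ conKeys n, k ∉ cur ∧ xk cc τ κ k ≠ 0 := by
        by_contra hcon
        push Not at hcon
        have e1 := viol_sound (xk cc τ κ) (conKeys n) cur hc hcon
        rw [con_sum hP hκ h1] at e1
        simp only [viol, bne_iff_ne, ne_eq] at h2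
        apply h2
        have l1 : ((conKeys n).filter fun k => cur.contains k).length % 2 < 2 :=
          Nat.mod_lt _ (by norm_num)
        have l2 : conPar n < 2 := by unfold conPar; split_ifs <;> norm_num
        have := (ZMod.natCast_eq_natCast_iff' _ _ 2).1 e1
        rw [Nat.mod_eq_of_lt l1, Nat.mod_eq_of_lt l2] at this
        exact this.symm
      obtain ⟨k, hk, hk1, hk2⟩ := this
      refine ⟨k, ?_, hk2⟩
      simp only [opts, List.mem_filter, Bool.and_eq_true, Bool.not_eq_true']
      refine ⟨hk, ⟨by simpa using hk1, ?_⟩, ?_⟩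
      · rw [← Bool.not_eq_true]
        intro h
        exact hk2 (he k (by simpa using h))
      · rw [← Bool.not_eq_true, List.any_eq_true]
        rintro ⟨l, hl, hl'⟩
        exact conf_sound hP hκ hadj hl' hk2 (hc l hl)
  | opt t₁ t₂ ih1 ih2 =>
    intro cur exc m h hc he hm
    cases m with
    | none => simp [chk] at h
    | some os =>
      cases os with
      | nil => simp [chk] at h
      | cons o os =>
        simp only [chk, Bool.and_eq_true] at h
        by_cases ho : xk cc τ κ o = 0
        · refine ih2 _ _ _ h.2 hc ?_ ?_
          · intro k hk
            rcases List.mem_cons.1 hk with rfl | hk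
            · exact ho
            · exact he k hk
          · intro os' hos'
            rw [Option.some_inj] at hos'
            subst hos'
            obtain ⟨k, hk, hk'⟩ := hm _ rfl
            rcases List.mem_cons.1 hk with rfl | hk
            · exact absurd ho hk'
            · exact ⟨k, hk, hk'⟩
        · refine ih1 _ _ _ h.1 ?_ he (by simp)
          intro k hk
          rcases List.mem_cons.1 hk with rfl | hk
          · exact ho
          · exact hc k hk
  | done =>
    intro cur exc m h hc he hm
    cases m with
    | none => simp [chk] at h
    | some os =>
      cases os with
      | nil =>
        obtain ⟨k, hk, -⟩ := hm _ rfl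
        simp at hk
      | cons o os => simp [chk] at h

lemma sig_inj : ∀ i < 8, ∀ a b : Fin 8, sig i a = sig i b → a = b := by decide +kernel

lemma sig_surj : ∀ i < 8, ∀ a : Fin 8, ∃ b, sig i b = a := by decide +kernel

lemma sig_cadj : ∀ i < 8, ∀ a b : Fin 8, cadj a b = true → cadj (sig i a) (sig i b) = true := by
  decide +kernel

lemma sig_anti : ∀ i < 8, ∀ a : Fin 8, sig i (a + 4) = sig i a + 4 := by decide +kernel

lemma sig_ind' : ∀ i < 8, (stdq.all fun q =>
    ind4 (sig i q.1) (sig i q.2.1) (sig i q.2.2.1) (sig i q.2.2.2)) = true := by decide +kernel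

lemma sig_ind (i : ℕ) (hi : i < 8) : ∀ q ∈ stdq,
    ind4 (sig i q.1) (sig i q.2.1) (sig i q.2.2.1) (sig i q.2.2.2) = true :=
  List.all_eq_true.1 (sig_ind' i hi)

/-- The standard keys. -/
def stdKeys : List ℕ := stdq.map fun q => nk q.1 q.2.1 q.2.2.1 q.2.2.2

lemma std_form : ∀ a b c d : Fin 8, nk a b c d ∈ stdKeys → ∃ q ∈ stdq,
    nk a b c d = nk q.1 q.2.1 q.2.2.1 q.2.2.2 := by
  intro a b c d h
  obtain ⟨q, hq, h⟩ := List.mem_map.1 h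
  exact ⟨q, hq, h.symm⟩

lemma stdq_ind_all : (stdq.all fun q => ind4 q.1 q.2.1 q.2.2.1 q.2.2.2) = true := by decide +kernel

lemma stdq_ind : ∀ q ∈ stdq, ind4 q.1 q.2.1 q.2.2.1 q.2.2.2 = true :=
  List.all_eq_true.1 stdq_ind_all

/-- Up to relabeling, the core is drawn as a cube with crossing face diagonals. -/
theorem exists_std (hP : IsPar H cc τ) (hκ : Function.Injective κ)
    (hadj : ∀ a b, cadj a b = true → H.Adj (κ a) (κ b)) :
    ∃ σ : Fin 8 → Fin 8, Function.Bijective σ ∧ (∀ a, σ (a + 4) = σ a + 4) ∧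
      (∀ a b, cadj a b = true → H.Adj (κ (σ a)) (κ (σ b))) ∧
      ∀ a b c d, ind4 a b c d = true → nk a b c d ∈ stdKeys →
        XX cc τ (κ (σ a)) (κ (σ b)) (κ (σ c)) (κ (σ d)) ≠ 0 := by
  obtain ⟨i, hi, h⟩ := chk_sound hP hκ hadj cert [] [] none chk_cert (by simp) (by simp) (by simp)
  have hinj : Function.Injective (sig i) := fun a b h => sig_inj i hi a b h
  refine ⟨sig i, ⟨hinj, sig_surj i hi⟩, sig_anti i hi,
    fun a b hab => hadj _ _ (sig_cadj i hi a b hab), ?_⟩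
  intro a b c d habcd hk
  obtain ⟨q, hq, e⟩ := std_form a b c d hk
  have hκ' : Function.Injective (κ ∘ sig i) := hκ.comp hinj
  have e1 := xk_nk hP hκ' habcd
  rw [e, xk_nk hP hκ' (stdq_ind q hq)] at e1
  simp only [Function.comp] at e1
  rw [← e1, ← xk_nk hP hκ (sig_ind i hi q hq)]
  exact h _ (List.mem_map.2 ⟨q, hq, rfl⟩)

/-- Triangle data: `yz` crosses `pq`, `qr` crosses `s₁t₁`, `pr` crosses `s₂t₂`. -/
structure TD where
  y : Fin 8
  z : Fin 8
  p : Fin 8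
  q : Fin 8
  r : Fin 8
  s₁ : Fin 8
  t₁ : Fin 8
  s₂ : Fin 8
  t₂ : Fin 8

/-- Table of triangle data. -/
def tdTab : List TD :=
  [⟨0, 5, 2, 3, 1, 0, 6, 0, 7⟩, ⟨0, 6, 1, 3, 2, 0, 5, 0, 7⟩, ⟨0, 7, 1, 2, 3, 0, 5, 0, 6⟩, ⟨5, 0, 2, 3, 4, 6, 5, 7, 5⟩, ⟨5, 6, 3, 4, 2, 7, 5, 0, 5⟩, ⟨5, 7, 2, 4, 3, 6, 5, 0, 5⟩, ⟨6, 0, 1, 3, 4, 6, 5, 7, 6⟩, ⟨6, 5, 3, 4, 1, 7, 6, 0, 6⟩, ⟨6, 7, 1, 4, 3, 6, 5, 0, 6⟩, ⟨7, 0, 1, 2, 4, 7, 5, 7, 6⟩, ⟨7, 5, 2, 4, 1, 7, 6, 0, 7⟩, ⟨7, 6, 1, 4, 2, 7, 5, 0, 7⟩, ⟨1, 2, 0, 7, 6, 1, 4, 1, 3⟩, ⟨1, 3, 0, 6, 7, 1, 4, 1, 2⟩, ⟨1, 4, 7, 6, 0, 1, 3, 1, 2⟩, ⟨2, 1, 0,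 7, 5, 2, 4, 2, 3⟩, ⟨2, 3, 0, 5, 7, 2, 4, 1, 2⟩, ⟨2, 4, 7, 5, 0, 2, 3, 1, 2⟩, ⟨3, 1, 0, 6, 5, 3, 4, 2, 3⟩, ⟨3, 2, 0, 5, 6, 3, 4, 1, 3⟩, ⟨3, 4, 6, 5, 0, 2, 3, 1, 3⟩, ⟨4, 1, 7, 6, 5, 3, 4, 2, 4⟩, ⟨4, 2, 7, 5, 6, 3, 4, 1, 4⟩, ⟨4, 3, 6, 5, 7, 2, 4, 1, 4⟩]

/-- Correctness of triangle data. -/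
def TD.ok (T : TD) : Bool :=
  cadj T.y T.z && cadj T.p T.q && cadj T.q T.r && cadj T.p T.r && cadj T.s₁ T.t₁ &&
  cadj T.s₂ T.t₂ && ind4 T.y T.z T.p T.q && ind4 T.s₁ T.t₁ T.q T.r && ind4 T.s₂ T.t₂ T.p T.r &&
  T.y != T.r && T.z != T.r && stdKeys.contains (nk T.y T.z T.p T.q) &&
  stdKeys.contains (nk T.s₁ T.t₁ T.q T.r) && stdKeys.contains (nk T.s₂ T.t₂ T.p T.r)

lemma tdTab_ok : ∀ T ∈ tdTab, T.ok = true := by decide +kernel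

/-- Tetrahedron of a core vertex. -/
def tet (a : Fin 8) : Bool := [1, 2, 3, 4].contains a.val

lemma tdTab_total : ∀ a b : Fin 8, a ≠ b → tet a = tet b →
    ∃ T ∈ tdTab, T.y = a ∧ T.z = b := by decide +kernel

lemma tdTab_anti : ∀ T ∈ tdTab, T.y + 4 ≠ T.p ∧ T.y + 4 ≠ T.q ∧ T.y + 4 ≠ T.r ∧
    cadj T.z (T.y + 4) = true ∧
    (∀ e : Fin 8 × Fin 8, e ∈ [(T.y, T.z), (T.s₁, T.t₁), (T.s₂, T.t₂)] →
      s(T.z, T.y + 4) ≠ s(e.1, e.2) ∧ s(T.y, T.y + 4) ≠ s(e.1, e.2)) := by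
  decide +kernel

end Rigid
section Rigid2

variable {V : Type} {H : SimpleGraph V} {cc : V → V → V → ZMod 2} {τ : V → V → ZMod 2}

/-- Winding function of a triangle. -/
def wnd (cc : V → V → V → ZMod 2) (p q r w : V) : ZMod 2 := cc p q w + cc q r w + cc p r w

lemma wnd_identity (p q r u v : V) :
    wnd cc p q r u + wnd cc p q r v = XX cc τ u v p q + XX cc τ u v q r + XX cc τ u v p r := by
  unfold wnd XX
  linear_combination (-(cc u v p + cc u v q + cc u v r + τ u p + τ u q + τ u r
    + τ v p + τ v q + τ v r)) * two_zmod2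

lemma zmod2_eq {x y : ZMod 2} (h : x + y = 0) : x = y := by
  linear_combination h - y * two_zmod2

lemma XX_zero (hP : IsPar H cc τ) {p q y z u v : V} (hpq : H.Adj p q) (hyz : H.Adj y z)
    (huv : H.Adj u v) (a1 : p ≠ y) (a2 : p ≠ z) (a3 : q ≠ y) (a4 : q ≠ z)
    (b1 : p ≠ u) (b2 : p ≠ v) (b3 : q ≠ u) (b4 : q ≠ v) (hx : XX cc τ y z p q ≠ 0)
    (hne : s(u, v) ≠ s(y, z)) : XX cc τ u v p q = 0 := by
  by_contra h
  rw [XX_symm hP b1 b2 b3 b4] at h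
  rw [XX_symm hP a1 a2 a3 a4] at hx
  exact hne (hP.mtch _ _ _ _ _ _ hpq huv hyz b1 b2 b3 b4 a1 a2 a3 a4 h hx)

lemma wnd_const (hP : IsPar H cc τ) {y z p q r s₁ t₁ s₂ t₂ : V} (hyz : H.Adj y z)
    (hpq : H.Adj p q) (hqr : H.Adj q r) (hpr : H.Adj p r) (h1 : H.Adj s₁ t₁) (h2 : H.Adj s₂ t₂)
    (a1 : p ≠ y) (a2 : p ≠ z) (a3 : q ≠ y) (a4 : q ≠ z)
    (b1 : q ≠ s₁) (b2 : q ≠ t₁) (b3 : r ≠ s₁) (b4 : r ≠ t₁)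
    (c1 : p ≠ s₂) (c2 : p ≠ t₂) (c3 : r ≠ s₂) (c4 : r ≠ t₂)
    (x1 : XX cc τ y z p q ≠ 0) (x2 : XX cc τ s₁ t₁ q r ≠ 0) (x3 : XX cc τ s₂ t₂ p r ≠ 0)
    {u v : V} (huv : H.Adj u v) (hpu : p ≠ u) (hpv : p ≠ v) (hqu : q ≠ u) (hqv : q ≠ v)
    (hru : r ≠ u) (hrv : r ≠ v) (n1 : s(u, v) ≠ s(y, z)) (n2 : s(u, v) ≠ s(s₁, t₁))
    (n3 : s(u, v) ≠ s(s₂, t₂)) : wnd cc p q r u = wnd cc p q r v := by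
  apply zmod2_eq
  rw [wnd_identity (τ := τ),
    XX_zero hP hpq hyz huv a1 a2 a3 a4 hpu hpv hqu hqv x1 n1,
    XX_zero hP hqr h1 huv b1 b2 b3 b4 hqu hqv hru hrv x2 n2,
    XX_zero hP hpr h2 huv c1 c2 c3 c4 hpu hpv hru hrv x3 n3]
  simp

lemma wnd_ne (hP : IsPar H cc τ) {y z p q r : V} (hyz : H.Adj y z)
    (hpq : H.Adj p q) (hqr : H.Adj q r) (hpr : H.Adj p r)
    (a1 : p ≠ y) (a2 : p ≠ z) (a3 : q ≠ y) (a4 : q ≠ z) (a5 : r ≠ y) (a6 : r ≠ z)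
    (x1 : XX cc τ y z p q ≠ 0) : wnd cc p q r y ≠ wnd cc p q r z := by
  intro h
  have e := wnd_identity (cc := cc) (τ := τ) p q r y z
  rw [h, zmod2_self] at e
  have e1 : XX cc τ y z q r = 0 := by
    by_contra h'
    have := hP.mtch _ _ _ _ _ _ hyz hpq hqr a1.symm a3.symm a2.symm a4.symm a3.symm a5.symm
      a4.symm a6.symm x1 h'
    rw [Sym2.eq_iff] at this
    rcases this with ⟨h, -⟩ | ⟨h, -⟩
    · exact hpq.ne h
    · exact hpr.ne h
  have e2 : XX cc τ y z p r = 0 := by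
    by_contra h'
    have := hP.mtch _ _ _ _ _ _ hyz hpq hpr a1.symm a3.symm a2.symm a4.symm a1.symm a5.symm
      a2.symm a6.symm x1 h'
    rw [Sym2.eq_iff] at this
    rcases this with ⟨-, h⟩ | ⟨h, -⟩
    · exact hqr.ne h
    · exact hpr.ne h
  rw [e1, e2, add_zero, add_zero] at e
  exact x1 e.symm

/-- Reaching `c` from `x` through vertices outside `C`. -/
inductive Rch (H : SimpleGraph V) (C : Set V) : V → V → Prop
  | base {x c : V} : x ∉ C → H.Adj x c → Rch H C x c
  | step {x y c : V} : x ∉ C → H.Adj x y → Rch H C y c → Rch H C x c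

lemma TD.wnd (hP : IsPar H cc τ) {κ : Fin 8 → V} (hκ : Function.Injective κ)
    (hadj : ∀ a b, cadj a b = true → H.Adj (κ a) (κ b))
    (hX : ∀ a b c d, ind4 a b c d = true → nk a b c d ∈ stdKeys →
        XX cc τ (κ a) (κ b) (κ c) (κ d) ≠ 0) {T : TD} (hT : T.ok = true) :
    ∃ g : V → ZMod 2, g (κ T.y) ≠ g (κ T.z) ∧
      ∀ u v, H.Adj u v → (∀ w ∈ [T.p, T.q, T.r], κ w ≠ u ∧ κ w ≠ v) →
        (∀ e : Fin 8 × Fin 8, e ∈ [(T.y, T.z), (T.s₁, T.t₁), (T.s₂, T.t₂)] →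
          s(u, v) ≠ s(κ e.1, κ e.2)) → g u = g v := by
  have K : ∀ {a b : Fin 8}, a ≠ b → κ b ≠ κ a := fun h h' => h (hκ h').symm
  simp only [TD.ok, Bool.and_eq_true, bne_iff_ne, ne_eq, List.contains_iff_mem] at hT
  obtain ⟨⟨⟨⟨⟨⟨⟨⟨⟨⟨⟨⟨⟨e1, e2⟩, e3⟩, e4⟩, e5⟩, e6⟩, i1⟩, i2⟩, i3⟩, n1⟩, n2⟩, k1⟩, k2⟩, k3⟩ := hT
  have x1 := hX _ _ _ _ i1 k1
  have x2 := hX _ _ _ _ i2 k2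
  have x3 := hX _ _ _ _ i3 k3
  simp only [ind4, Bool.and_eq_true, bne_iff_ne, ne_eq] at i1 i2 i3
  obtain ⟨⟨⟨a1, a2⟩, a3⟩, a4⟩ := i1
  obtain ⟨⟨⟨b1, b2⟩, b3⟩, b4⟩ := i2
  obtain ⟨⟨⟨c1, c2⟩, c3⟩, c4⟩ := i3
  refine ⟨_root_.wnd cc (κ T.p) (κ T.q) (κ T.r), ?_, ?_⟩
  · exact wnd_ne hP (hadj _ _ e1) (hadj _ _ e2) (hadj _ _ e3) (hadj _ _ e4)
      (K a1) (K a3) (K a2) (K a4) (K n1) (K n2) x1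
  · intro u v huv hw he
    exact wnd_const hP (hadj _ _ e1) (hadj _ _ e2) (hadj _ _ e3) (hadj _ _ e4) (hadj _ _ e5)
      (hadj _ _ e6) (K a1) (K a3) (K a2) (K a4) (K b1) (K b3) (K b2) (K b4) (K c1) (K c3)
      (K c2) (K c4) x1 x2 x3 huv (hw T.p (by simp)).1 (hw T.p (by simp)).2 (hw T.q (by simp)).1
      (hw T.q (by simp)).2 (hw T.r (by simp)).1 (hw T.r (by simp)).2
      (he (T.y, T.z) (by simp)) (he (T.s₁, T.t₁) (by simp)) (he (T.s₂, T.t₂) (by simp))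

lemma TD.yz {T : TD} (hT : T.ok = true) :
    ∀ w ∈ [T.p, T.q, T.r], w ≠ T.y ∧ w ≠ T.z := by
  simp only [TD.ok, Bool.and_eq_true, bne_iff_ne, ne_eq, List.contains_iff_mem] at hT
  obtain ⟨⟨⟨⟨⟨⟨⟨⟨⟨⟨⟨⟨⟨e1, e2⟩, e3⟩, e4⟩, e5⟩, e6⟩, i1⟩, i2⟩, i3⟩, n1⟩, n2⟩, k1⟩, k2⟩, k3⟩ := hT
  simp only [ind4, Bool.and_eq_true, bne_iff_ne, ne_eq] at i1
  obtain ⟨⟨⟨a1, a2⟩, a3⟩, a4⟩ := i1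
  intro w hw
  simp only [List.mem_cons, List.not_mem_nil, or_false] at hw
  rcases hw with rfl | rfl | rfl
  · exact ⟨Ne.symm a1, Ne.symm a3⟩
  · exact ⟨Ne.symm a2, Ne.symm a4⟩
  · exact ⟨Ne.symm n1, Ne.symm n2⟩

lemma tet_pigeon : ∀ a b c : Fin 8, tet a = tet b ∨ tet a = tet c ∨ tet b = tet c := by
  decide +kernel

lemma rigidA_aux (hP : IsPar H cc τ) {κ : Fin 8 → V} (hκ : Function.Injective κ)
    (hadj : ∀ a b, cadj a b = true → H.Adj (κ a) (κ b))
    (hX : ∀ a b c d, ind4 a b c d = true → nk a b c d ∈ stdKeys →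
        XX cc τ (κ a) (κ b) (κ c) (κ d) ≠ 0) {x : V} {a b : Fin 8} (hab : a ≠ b)
    (ht : tet a = tet b) (ha : Rch H (range κ) x (κ a)) (hb : Rch H (range κ) x (κ b)) :
    False := by
  obtain ⟨T, hT, rfl, rfl⟩ := tdTab_total a b hab ht
  have hok := tdTab_ok T hT
  obtain ⟨g, hg1, hg2⟩ := TD.wnd hP hκ hadj hX hok
  have hyz := TD.yz hok
  have key : ∀ x' c, Rch H (range κ) x' (κ c) → (∀ w ∈ [T.p, T.q, T.r], w ≠ c) →
      g x' = g (κ c) := by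
    intro x' c hr hc
    generalize hd : κ c = d at hr
    induction hr with
    | base hx hxc =>
      subst hd
      refine hg2 _ _ hxc (fun w hw => ⟨fun h => hx ⟨w, h⟩, fun h => hc w hw (hκ h)⟩) ?_
      intro e _ h
      rw [Sym2.eq_iff] at h
      rcases h with ⟨h, -⟩ | ⟨h, -⟩ <;> exact hx ⟨_, h.symm⟩
    | step hx hxy hr' ih =>
      rename_i x y c'
      have hy : y ∉ range κ := by cases hr' <;> assumption
      rw [← ih hd]
      refine hg2 _ _ hxy (fun w hw => ⟨fun h => hx ⟨w, h⟩, fun h => hy ⟨w, h⟩⟩) ?_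
      intro e _ h
      rw [Sym2.eq_iff] at h
      rcases h with ⟨h, -⟩ | ⟨h, -⟩ <;> exact hx ⟨_, h.symm⟩
  apply hg1
  rw [← key x _ ha fun w hw => (hyz w hw).1, ← key x _ hb fun w hw => (hyz w hw).2]

/-- No outside vertex can reach three core vertices. -/
theorem rigidA [Finite V] (h1 : H.IsOnePlanar) {κ : Fin 8 → V} (hκ : Function.Injective κ)
    (hadj : ∀ a b, cadj a b = true → H.Adj (κ a) (κ b)) {x : V} {a b c : Fin 8}
    (hab : a ≠ b) (hac : a ≠ c) (hbc : b ≠ c) (ha : Rch H (range κ) x (κ a))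
    (hb : Rch H (range κ) x (κ b)) (hc : Rch H (range κ) x (κ c)) : False := by
  obtain ⟨cc, τ, hP⟩ := exists_isPar h1
  obtain ⟨σ, hσ, h2, h3, h4⟩ := exists_std hP hκ hadj
  have hκ' : Function.Injective (κ ∘ σ) := hκ.comp hσ.1
  have hr : range (κ ∘ σ) = range κ := hσ.2.range_comp κ
  obtain ⟨a, rfl⟩ := hσ.2 a
  obtain ⟨b, rfl⟩ := hσ.2 b
  obtain ⟨c, rfl⟩ := hσ.2 c
  rw [← hr] at ha hb hc
  rcases tet_pigeon a b c with h | h | h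
  · exact rigidA_aux (κ := κ ∘ σ) hP hκ' h3 h4 (fun e => hab (congrArg σ e)) h ha hb
  · exact rigidA_aux (κ := κ ∘ σ) hP hκ' h3 h4 (fun e => hac (congrArg σ e)) h ha hc
  · exact rigidA_aux (κ := κ ∘ σ) hP hκ' h3 h4 (fun e => hbc (congrArg σ e)) h hb hc

lemma tdTab_left : ∀ a : Fin 8, ∃ T ∈ tdTab, T.y = a := by decide +kernel

lemma sym2_map_ne {κ : Fin 8 → V} (hκ : Function.Injective κ) {a b c d : Fin 8}
    (h : s(a, b) ≠ s(c, d)) : s(κ a, κ b) ≠ s(κ c, κ d) := by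
  intro h'
  apply h
  have : Sym2.map κ s(a, b) = Sym2.map κ s(c, d) := h'
  exact Sym2.map.injective hκ this

/-- Antipodal core vertices cannot be adjacent. -/
theorem rigidB [Finite V] (h1 : H.IsOnePlanar) {κ : Fin 8 → V} (hκ : Function.Injective κ)
    (hadj : ∀ a b, cadj a b = true → H.Adj (κ a) (κ b)) {a : Fin 8}
    (ha : H.Adj (κ a) (κ (a + 4))) : False := by
  obtain ⟨cc, τ, hP⟩ := exists_isPar h1
  obtain ⟨σ, hσ, h2, h3, h4⟩ := exists_std hP hκ hadj
  have hκ' : Function.Injective (κ ∘ σ) := hκ.comp hσ.1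
  obtain ⟨a, rfl⟩ := hσ.2 a
  rw [← h2] at ha
  obtain ⟨T, hT, rfl⟩ := tdTab_left a
  have hok := tdTab_ok T hT
  obtain ⟨g, hg1, hg2⟩ := TD.wnd (κ := κ ∘ σ) hP hκ' h3 h4 hok
  have hyz := TD.yz hok
  obtain ⟨n1, n2, n3, hc, he⟩ := tdTab_anti T hT
  have hw : ∀ w ∈ [T.p, T.q, T.r], w ≠ T.y + 4 := by
    intro w hw
    simp only [List.mem_cons, List.not_mem_nil, or_false] at hw
    rcases hw with rfl | rfl | rfl
    · exact Ne.symm n1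
    · exact Ne.symm n2
    · exact Ne.symm n3
  have e1 := hg2 _ _ ha
    (fun w hw' => ⟨fun h => (hyz w hw').1 (hκ' h), fun h => hw w hw' (hκ' h)⟩)
    (fun e hee => sym2_map_ne hκ' (he e hee).2)
  have e2 := hg2 _ _ (h3 _ _ hc)
    (fun w hw' => ⟨fun h => (hyz w hw').2 (hκ' h), fun h => hw w hw' (hκ' h)⟩)
    (fun e hee => sym2_map_ne hκ' (he e hee).1)
  exact hg1 (e1.trans e2.symm)

end Rigid2

/-! ### Part 3: the graph and its maximality -/

/-- Vertices of the graph with `k` pages. -/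
abbrev W (k : ℕ) : Type := Fin 3 ⊕ (Fin k × Fin 17)

/-- Indices of the edges of the graph with `k` pages. -/
abbrev J (k : ℕ) : Type := Fin 3 ⊕ (Fin k × Fin 45)

/-- Local labels of a page as shared or private vertices. -/
def sh (a : Fin 20) : Fin 3 ⊕ Fin 17 :=
  if a.val < 2 then .inl (Fin.ofNat 3 a.val) else if a.val = 8 then .inl 2
  else if a.val < 8 then .inr (Fin.ofNat 17 (a.val - 2)) else .inr (Fin.ofNat 17 (a.val - 3))

/-- Inverse of `sh`. -/
def unsh : Fin 3 ⊕ Fin 17 → Fin 20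
  | .inl c => if c.val < 2 then Fin.ofNat 20 c.val else 8
  | .inr d => if d.val < 6 then Fin.ofNat 20 (d.val + 2) else Fin.ofNat 20 (d.val + 3)

lemma unsh_sh : ∀ a, unsh (sh a) = a := by decide +kernel

lemma sh_unsh : ∀ a, sh (unsh a) = a := by decide +kernel

/-- Placing a label on page `i`. -/
def plc {k : ℕ} (i : Fin k) : Fin 3 ⊕ Fin 17 → W k
  | .inl c => .inl c
  | .inr d => .inr (i, d)

/-- The vertex of page `i` with local label `a`. -/
def loc {k : ℕ} (i : Fin k) (a : Fin 20) : W k := plc i (sh a)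

/-- The local label of a vertex. -/
def lab {k : ℕ} : W k → Fin 20
  | .inl c => unsh (.inl c)
  | .inr (_, d) => unsh (.inr d)

lemma lab_plc {k : ℕ} (i : Fin k) (s : Fin 3 ⊕ Fin 17) : lab (plc i s) = unsh s := by
  cases s <;> rfl

lemma lab_loc {k : ℕ} (i : Fin k) (a : Fin 20) : lab (loc i a) = a := by
  rw [loc, lab_plc, unsh_sh]

lemma loc_inj {k : ℕ} (i : Fin k) : Function.Injective (loc i) := fun a b h => by
  rw [← lab_loc i a, h, lab_loc]

/-- Private labels. -/
def prv (a : Fin 20) : Bool := (sh a).isRight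

lemma loc_page {k : ℕ} {i j : Fin k} {a b : Fin 20} (ha : prv a = true)
    (h : loc i a = loc j b) : i = j := by
  unfold loc at h
  unfold prv at ha
  cases hs : sh a with
  | inl c => rw [hs] at ha; simp at ha
  | inr d =>
    rw [hs] at h
    cases hs' : sh b with
    | inl c => rw [hs'] at h; simp [plc] at h
    | inr d' =>
      rw [hs'] at h
      simp only [plc, Sum.inr.injEq, Prod.mk.injEq] at h
      exact h.1

lemma loc_shared {k : ℕ} {i j : Fin k} {a : Fin 20} (ha : prv a = false) :
    loc i a = loc j a := by
  unfold loc
  unfold prv at ha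
  cases hs : sh a with
  | inl c => rfl
  | inr d => rw [hs] at ha; simp at ha

lemma exists_loc {k : ℕ} (hk : 0 < k) (x : W k) : ∃ i a, x = loc i a := by
  rcases x with c | ⟨i, d⟩
  · exact ⟨⟨0, hk⟩, unsh (.inl c), by rw [loc, sh_unsh]; rfl⟩
  · exact ⟨i, unsh (.inr d), by rw [loc, sh_unsh]; rfl⟩

/-- Common edges, by local labels. -/
def cEL : List (Fin 20 × Fin 20) := [(0, 1), (0, 8), (1, 8)]

/-- Page edges, by local labels. -/
def pEL : List (Fin 20 × Fin 20) :=
  [(0, 2), (0, 3), (0, 5), (0, 6), (0, 7), (1, 2), (1, 3), (1, 4), (1, 6), (1, 7), (2, 3), (2,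
    4), (2, 5), (2, 7), (3, 4), (3, 5), (3, 6), (4, 5), (4, 6), (4, 7), (5, 6), (5, 7), (6,
    7), (0, 9), (2, 9), (0, 10), (3, 10), (4, 11), (5, 11), (4, 12), (6, 12), (4, 13), (7,
    13), (1, 14), (6, 14), (1, 15), (7, 15), (2, 16), (5, 16), (2, 17), (7, 17), (3, 18),
    (5, 18), (3, 19), (6, 19)]

/-- The common edges. -/
def cE (e : Fin 3) : Fin 20 × Fin 20 := cEL.getD e.val (0, 0)

/-- The page edges. -/
def pE (e : Fin 45) : Fin 20 × Fin 20 := pEL.getD e.val (0, 0)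

/-- Vertices shared by all the pages. -/
def com (k : ℕ) (a : Fin 20) : W k := .inl (Fin.ofNat 3 (if a.val = 8 then 2 else a.val))

/-- The endpoints of the edges. -/
def iota (k : ℕ) : J k → Sym2 (W k)
  | .inl e => s(com k (cE e).1, com k (cE e).2)
  | .inr (i, e) => s(loc i (pE e).1, loc i (pE e).2)

lemma cE_lab {k : ℕ} : ∀ e : Fin 3, lab (com k (cE e).1) = (cE e).1 ∧
    lab (com k (cE e).2) = (cE e).2 := by
  have : ∀ e : Fin 3, unsh (.inl (Fin.ofNat 3 (if (cE e).1.val = 8 then 2 else (cE e).1.val)))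
      = (cE e).1 ∧ unsh (.inl (Fin.ofNat 3 (if (cE e).2.val = 8 then 2 else (cE e).2.val)))
      = (cE e).2 := by decide +kernel
  exact this

lemma cE_inj : ∀ e f : Fin 3, s((cE e).1, (cE e).2) = s((cE f).1, (cE f).2) → e = f := by
  decide +kernel

lemma pE_inj : ∀ e f : Fin 45, s((pE e).1, (pE e).2) = s((pE f).1, (pE f).2) → e = f := by
  decide +kernel

lemma cE_pE : ∀ (e : Fin 3) (f : Fin 45), s((cE e).1, (cE e).2) ≠ s((pE f).1, (pE f).2) := by
  decide +kernel

lemma pE_prv : ∀ e : Fin 45, prv (pE e).2 = true := by decide +kernel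

lemma pE_ne : ∀ e : Fin 45, (pE e).1 ≠ (pE e).2 := by decide +kernel

lemma cE_ne : ∀ e : Fin 3, (cE e).1 ≠ (cE e).2 := by decide +kernel

lemma lab_iota_l {k : ℕ} (e : Fin 3) :
    Sym2.map lab (iota k (.inl e)) = s((cE e).1, (cE e).2) := by
  simp only [iota, Sym2.map_mk, cE_lab]

lemma lab_iota_r {k : ℕ} (i : Fin k) (e : Fin 45) :
    Sym2.map lab (iota k (.inr (i, e))) = s((pE e).1, (pE e).2) := by
  simp only [iota, Sym2.map_mk, lab_loc]

lemma iota_inj (k : ℕ) : Function.Injective (iota k) := by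
  intro x y h
  have h' := congrArg (Sym2.map lab) h
  rcases x with e | ⟨i, e⟩ <;> rcases y with f | ⟨j, f⟩
  · rw [lab_iota_l, lab_iota_l] at h'
    rw [cE_inj e f h']
  · rw [lab_iota_l, lab_iota_r] at h'
    exact absurd h' (cE_pE e f)
  · rw [lab_iota_l, lab_iota_r] at h'
    exact absurd h'.symm (cE_pE f e)
  · rw [lab_iota_r, lab_iota_r] at h'
    have := pE_inj e f h'
    subst this
    have hm : loc i (pE e).2 ∈ iota k (.inr (j, e)) := by
      rw [← h]; simp [iota]
    simp only [iota, Sym2.mem_iff] at hm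
    have : i = j := by
      rcases hm with hm | hm <;> exact loc_page (pE_prv e) hm
    rw [this]

lemma iota_not_diag (k : ℕ) (x : J k) : ¬ (iota k x).IsDiag := by
  rcases x with e | ⟨i, e⟩
  · simp only [iota, Sym2.mk_isDiag_iff]
    intro h
    have := congrArg lab h
    rw [(cE_lab e).1, (cE_lab e).2] at this
    exact cE_ne e this
  · simp only [iota, Sym2.mk_isDiag_iff]
    exact fun h => pE_ne e (loc_inj i h)

/-- The graph. -/
def GG (k : ℕ) : SimpleGraph (W k) := SimpleGraph.fromEdgeSet (range (iota k))

lemma GG_edgeSet (k : ℕ) : (GG k).edgeSet = range (iota k) := by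
  rw [GG, SimpleGraph.edgeSet_fromEdgeSet]
  ext x
  simp only [Set.mem_sdiff]
  constructor
  · exact fun h => h.1
  · rintro ⟨j, rfl⟩
    exact ⟨⟨j, rfl⟩, iota_not_diag k j⟩

lemma GG_ncard (k : ℕ) : (GG k).edgeSet.ncard = 45 * k + 3 := by
  rw [GG_edgeSet, ← Set.image_univ, Set.ncard_image_of_injective _ (iota_inj k), Set.ncard_univ]
  simp [Nat.card_eq_fintype_card]
  ring

/-- Local adjacency. -/
def ladj (a b : Fin 20) : Bool :=
  (cEL ++ pEL).any fun e => e == (a, b) || e == (b, a)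

lemma ladj_sound : ∀ a b, ladj a b = true → (∃ e : Fin 3, s((cE e).1, (cE e).2) = s(a, b)) ∨
    ∃ e : Fin 45, s((pE e).1, (pE e).2) = s(a, b) := by
  decide +kernel

lemma cE_loc {k : ℕ} (i : Fin k) (e : Fin 3) :
    com k (cE e).1 = loc i (cE e).1 ∧ com k (cE e).2 = loc i (cE e).2 := by
  have : ∀ e : Fin 3, sh (cE e).1 = .inl (Fin.ofNat 3 (if (cE e).1.val = 8 then 2 else (cE e).1.val))
    ∧ sh (cE e).2 = .inl (Fin.ofNat 3 (if (cE e).2.val = 8 then 2 else (cE e).2.val)) := by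
    decide +kernel
  unfold loc
  rw [(this e).1, (this e).2]
  exact ⟨rfl, rfl⟩

lemma GG_adj {k : ℕ} (i : Fin k) {a b : Fin 20} (h : ladj a b = true) :
    (GG k).Adj (loc i a) (loc i b) := by
  rw [← SimpleGraph.mem_edgeSet, GG_edgeSet]
  rcases ladj_sound a b h with ⟨e, he⟩ | ⟨e, he⟩
  · refine ⟨.inl e, ?_⟩
    have := congrArg (Sym2.map (loc i)) he
    simp only [Sym2.map_mk] at this
    rw [iota, (cE_loc i e).1, (cE_loc i e).2]
    exact this
  · refine ⟨.inr (i, e), ?_⟩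
    have := congrArg (Sym2.map (loc i)) he
    simp only [Sym2.map_mk] at this
    exact this

/-- The core of page `i`. -/
def kap {k : ℕ} (i : Fin k) (c : Fin 8) : W k := loc i (Fin.ofNat 20 c.val)

lemma kap_inj {k : ℕ} (i : Fin k) : Function.Injective (kap i) := by
  intro a b h
  have h' := loc_inj i h
  revert h'
  revert a b
  have : ∀ a b : Fin 8, Fin.ofNat 20 a.val = Fin.ofNat 20 b.val → a = b := by decide +kernel
  intro a b _ h'
  exact this a b h'

lemma cadj_ladj : ∀ a b : Fin 8, cadj a b = true →
    ladj (Fin.ofNat 20 a.val) (Fin.ofNat 20 b.val) = true := by decide +kernel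

lemma not_kap {k : ℕ} (i : Fin k) {a : Fin 20} (ha : 8 ≤ a.val) : loc i a ∉ range (kap i) := by
  rintro ⟨c, hc⟩
  have := loc_inj i hc
  have := congrArg Fin.val this
  simp only [Fin.ofNat] at this
  omega

lemma not_kap' {k : ℕ} {i j : Fin k} (hij : i ≠ j) {a : Fin 20} (ha : prv a = true) :
    loc j a ∉ range (kap i) := by
  rintro ⟨c, hc⟩
  exact hij (loc_page ha hc.symm).symm

/-- Core neighbours of hermits. -/
def hnb (a : Fin 20) : Fin 8 × Fin 8 :=
  ([(0, 1), (0, 2), (0, 3), (4, 5), (4, 6), (4, 7), (1, 6), (1, 7), (2, 5), (2, 7), (3, 5), (3, 6)] :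
    List (Fin 8 × Fin 8)).getD (a.val - 8) (0, 0)

/-- Core labels as local labels. -/
def cl (c : Fin 8) : Fin 20 := Fin.ofNat 20 c.val

lemma hnb_adj : ∀ a : Fin 20, 8 ≤ a.val → ladj a (cl (hnb a).1) = true ∧
    ladj a (cl (hnb a).2) = true ∧ (hnb a).1 ≠ (hnb a).2 := by decide +kernel

lemma hnb_only : ∀ (a : Fin 20) (c : Fin 8), 8 ≤ a.val → ladj a (cl c) = false →
    c ≠ (hnb a).1 ∧ c ≠ (hnb a).2 := by decide +kernel

lemma hnb_diff : ∀ a b : Fin 20, 8 ≤ a.val → 8 ≤ b.val → a ≠ b →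
    ((hnb b).1 ≠ (hnb a).1 ∧ (hnb b).1 ≠ (hnb a).2) ∨
    ((hnb b).2 ≠ (hnb a).1 ∧ (hnb b).2 ≠ (hnb a).2) := by decide +kernel

lemma core_nonadj : ∀ a b : Fin 8, a ≠ b → ladj (cl a) (cl b) = false → b = a + 4 := by
  decide +kernel

lemma cl_or (a : Fin 20) : (∃ c, a = cl c) ∨ 8 ≤ a.val := by
  by_cases h : a.val < 8
  · refine Or.inl ⟨⟨a.val, h⟩, ?_⟩
    apply Fin.ext
    simp only [cl, Fin.ofNat]
    omega
  · exact Or.inr (not_lt.1 h)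

lemma prv_reach : ∀ (b : Fin 20) (t : Fin 8), prv b = true → t.val < 2 → ladj b (cl t) = true ∨
    ∃ d, prv d = true ∧ ladj b d = true ∧ (ladj d (cl t) = true ∨
      ∃ d', prv d' = true ∧ ladj d d' = true ∧ ladj d' (cl t) = true) := by decide +kernel

lemma prv_third : ∀ a : Fin 20, prv a = true → 8 ≤ a.val →
    ((hnb a).1 ≠ 0 ∧ (hnb a).1 ≠ 1) ∨ ((hnb a).2 ≠ 0 ∧ (hnb a).2 ≠ 1) := by decide +kernel

lemma cl_prv : ∀ c : Fin 8, prv (cl c) = true → c ≠ 0 ∧ c ≠ 1 := by decide +kernel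

lemma cl_shared : ∀ t : Fin 8, t.val < 2 → prv (cl t) = false := by decide +kernel

lemma prv_not_lt : ∀ a : Fin 20, prv a = false → (∃ t : Fin 8, t.val < 2 ∧ a = cl t) ∨ a = 8 := by
  decide +kernel

lemma ladj_symm (a b : Fin 20) : ladj a b = ladj b a := by
  unfold ladj
  congr 1
  funext e
  rw [Bool.or_comm]

section Max

variable {k : ℕ} {H : SimpleGraph (W k)}

lemma max_same_aux (hG : GG k ≤ H) (h1 : H.IsOnePlanar) (i : Fin k) {a b : Fin 20}
    (hH : H.Adj (loc i a) (loc i b)) (hab : a ≠ b) (hn : ladj a b = false) (hb : 8 ≤ b.val) :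
    False := by
  have hadj : ∀ a b, cadj a b = true → H.Adj (kap i a) (kap i b) := fun a b h =>
    hG (GG_adj i (cadj_ladj a b h))
  have nb := not_kap i hb
  obtain ⟨b1, b2, b3⟩ := hnb_adj b hb
  have r1 : Rch H (range (kap i)) (loc i b) (kap i (hnb b).1) := .base nb (hG (GG_adj i b1))
  have r2 : Rch H (range (kap i)) (loc i b) (kap i (hnb b).2) := .base nb (hG (GG_adj i b2))
  rcases cl_or a with ⟨c, rfl⟩ | ha
  · rw [ladj_symm] at hn
    obtain ⟨n1, n2⟩ := hnb_only b c hb hn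
    exact rigidA h1 (kap_inj i) hadj b3 n1.symm n2.symm r1 r2 (.base nb hH.symm)
  · have na := not_kap i ha
    obtain ⟨a1, a2, a3⟩ := hnb_adj a ha
    have s1 : Rch H (range (kap i)) (loc i b) (kap i (hnb a).1) :=
      .step nb hH.symm (.base na (hG (GG_adj i a1)))
    have s2 : Rch H (range (kap i)) (loc i b) (kap i (hnb a).2) :=
      .step nb hH.symm (.base na (hG (GG_adj i a2)))
    rcases hnb_diff b a hb ha hab.symm with ⟨n1, n2⟩ | ⟨n1, n2⟩
    · exact rigidA h1 (kap_inj i) hadj b3 n1.symm n2.symm r1 r2 s1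
    · exact rigidA h1 (kap_inj i) hadj b3 n1.symm n2.symm r1 r2 s2

lemma max_same (hG : GG k ≤ H) (h1 : H.IsOnePlanar) (i : Fin k) {a b : Fin 20}
    (hH : H.Adj (loc i a) (loc i b)) (hn : ¬ (GG k).Adj (loc i a) (loc i b)) : False := by
  have hab : a ≠ b := fun h => hH.ne (congrArg _ h)
  have hn' : ladj a b = false := by
    rw [← Bool.not_eq_true]
    exact fun h => hn (GG_adj i h)
  have hadj : ∀ a b, cadj a b = true → H.Adj (kap i a) (kap i b) := fun a b h =>
    hG (GG_adj i (cadj_ladj a b h))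
  rcases cl_or b with ⟨d, rfl⟩ | hb
  · rcases cl_or a with ⟨c, rfl⟩ | ha
    · have := core_nonadj c d (fun h => hab (congrArg _ h)) hn'
      subst this
      exact rigidB h1 (kap_inj i) hadj hH
    · exact max_same_aux hG h1 i hH.symm hab.symm (by rw [ladj_symm]; exact hn') ha
  · exact max_same_aux hG h1 i hH hab hn' hb

lemma max_diff (hG : GG k ≤ H) (h1 : H.IsOnePlanar) {i j : Fin k} (hij : i ≠ j) {a b : Fin 20}
    (ha : prv a = true) (hb : prv b = true) (hH : H.Adj (loc i a) (loc j b)) : False := by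
  have hadj : ∀ a b, cadj a b = true → H.Adj (kap i a) (kap i b) := fun a b h =>
    hG (GG_adj i (cadj_ladj a b h))
  have rt : ∀ t : Fin 8, t.val < 2 → Rch H (range (kap i)) (loc j b) (kap i t) := by
    intro t ht
    have e : kap i t = loc j (cl t) := loc_shared (cl_shared t ht)
    rw [e]
    rcases prv_reach b t hb ht with h | ⟨d, hd, hbd, h | ⟨d', hd', hdd, h⟩⟩
    · exact .base (not_kap' hij hb) (hG (GG_adj j h))
    · exact .step (not_kap' hij hb) (hG (GG_adj j hbd)) (.base (not_kap' hij hd) (hG (GG_adj j h)))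
    · exact .step (not_kap' hij hb) (hG (GG_adj j hbd)) (.step (not_kap' hij hd)
        (hG (GG_adj j hdd)) (.base (not_kap' hij hd') (hG (GG_adj j h))))
  have r0 := rt 0 (by norm_num)
  have r1 := rt 1 (by norm_num)
  have nb := not_kap' hij hb
  rcases cl_or a with ⟨c, rfl⟩ | ha'
  · obtain ⟨c0, c1⟩ := cl_prv c ha
    exact rigidA h1 (kap_inj i) hadj (by decide) c0.symm c1.symm r0 r1 (.base nb hH.symm)
  · have na := not_kap i ha'
    obtain ⟨a1, a2, a3⟩ := hnb_adj a ha'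
    rcases prv_third a ha ha' with ⟨n1, n2⟩ | ⟨n1, n2⟩
    · exact rigidA h1 (kap_inj i) hadj (by decide) n1.symm n2.symm r0 r1
        (.step nb hH.symm (.base na (hG (GG_adj i a1))))
    · exact rigidA h1 (kap_inj i) hadj (by decide) n1.symm n2.symm r0 r1
        (.step nb hH.symm (.base na (hG (GG_adj i a2))))

theorem GG_max (hk : 0 < k) (hlt : GG k < H) : ¬ H.IsOnePlanar := by
  intro h1
  have hG := hlt.le
  obtain ⟨x, y, hH, hn⟩ : ∃ x y, H.Adj x y ∧ ¬ (GG k).Adj x y := by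
    by_contra hcon
    push Not at hcon
    exact hlt.not_ge fun x y h => hcon x y h
  obtain ⟨i, a, rfl⟩ := exists_loc hk x
  obtain ⟨j, b, rfl⟩ := exists_loc hk y
  by_cases hb : prv b = true
  · by_cases ha : prv a = true
    · by_cases hij : i = j
      · subst hij
        exact max_same hG h1 i hH hn
      · exact max_diff hG h1 hij ha hb hH
    · rw [loc_shared (i := i) (j := j) (by simpa using ha)] at hH hn
      exact max_same hG h1 j hH hn
  · rw [loc_shared (i := j) (j := i) (by simpa using hb)] at hH hn
    exact max_same hG h1 i hH hn

end Max

/-! ### Part 4: the drawing -/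

/-- Integer points. -/
abbrev Z2 : Type := ℤ × ℤ

/-- Orientation of a triple of integer points. -/
def ori (P M X : Z2) : ℤ := (M.1 - P.1) * (X.2 - P.2) - (M.2 - P.2) * (X.1 - P.1)

/-- An integer point as a point of the plane. -/
def toR (P : Z2) : Plane := ((P.1 : ℝ), (P.2 : ℝ))

/-- The parametrised segment. -/
def seg (P M : Z2) (s : ℝ) : Plane :=
  ((P.1 : ℝ) + s * ((M.1 : ℝ) - P.1), (P.2 : ℝ) + s * ((M.2 : ℝ) - P.2))

/-- The half-open segment from `P` (excluded) to `M` (included). -/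
def piece (P M : Z2) : Set Plane := {z | ∃ s : ℝ, 0 < s ∧ s ≤ 1 ∧ z = seg P M s}

/-- The two-piece polygonal arc. -/
def poly (P M Q : Z2) (t : ℝ) : Plane := if t ≤ 1 / 2 then seg P M (2 * t) else seg Q M (2 - 2 * t)

lemma poly_zero (P M Q : Z2) : poly P M Q 0 = toR P := by
  unfold poly seg toR
  norm_num

lemma poly_one (P M Q : Z2) : poly P M Q 1 = toR Q := by
  unfold poly seg toR
  norm_num

lemma poly_cont (P M Q : Z2) : Continuous (poly P M Q) := by
  unfold poly
  refine Continuous.if_le ?_ ?_ continuous_id continuous_const ?_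
  · unfold seg; fun_prop
  · unfold seg; fun_prop
  · intro t ht
    have ht : t = 1 / 2 := ht
    subst ht
    unfold seg
    norm_num

lemma poly_sub (P M Q : Z2) : poly P M Q '' Ioo 0 1 ⊆ piece P M ∪ piece Q M := by
  rintro _ ⟨t, ⟨h0, h1⟩, rfl⟩
  unfold poly
  split_ifs with h
  · exact Or.inl ⟨2 * t, by linarith, by linarith, rfl⟩
  · exact Or.inr ⟨2 - 2 * t, by linarith, by push Not at h; linarith, rfl⟩

lemma bent_inj (a b c : ℝ) (h : (a < b ∧ b < c) ∨ (b < a ∧ c < b)) {t t' : ℝ}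
    (ht : t ∈ Icc (0:ℝ) 1) (ht' : t' ∈ Icc (0:ℝ) 1)
    (he : (if t ≤ 1 / 2 then a + 2 * t * (b - a) else c + (2 - 2 * t) * (b - c)) =
      (if t' ≤ 1 / 2 then a + 2 * t' * (b - a) else c + (2 - 2 * t') * (b - c))) : t = t' := by
  obtain ⟨h0, h1⟩ := ht
  obtain ⟨h0', h1'⟩ := ht'
  have hba : b - a ≠ 0 := by
    rcases h with h | h
    · exact (by linarith : 0 < b - a).ne'
    · exact (by linarith : b - a < 0).ne
  have hbc : b - c ≠ 0 := by
    rcases h with h | h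
    · exact (by linarith : b - c < 0).ne
    · exact (by linarith : 0 < b - c).ne'
  split_ifs at he with h2 h2' h2'
  · have : (t - t') * (b - a) = 0 := by linarith
    rcases mul_eq_zero.1 this with h | h
    · linarith
    · exact absurd h hba
  · exfalso
    push Not at h2'
    rcases h with h | h
    · nlinarith [mul_nonneg (by linarith : 0 ≤ 1 - 2 * t) (by linarith : 0 ≤ b - a),
        mul_pos (by linarith : 0 < 2 * t' - 1) (by linarith : 0 < c - b)]
    · nlinarith [mul_nonneg (by linarith : 0 ≤ 1 - 2 * t) (by linarith : 0 ≤ a - b),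
        mul_pos (by linarith : 0 < 2 * t' - 1) (by linarith : 0 < b - c)]
  · exfalso
    push Not at h2
    rcases h with h | h
    · nlinarith [mul_nonneg (by linarith : 0 ≤ 1 - 2 * t') (by linarith : 0 ≤ b - a),
        mul_pos (by linarith : 0 < 2 * t - 1) (by linarith : 0 < c - b)]
    · nlinarith [mul_nonneg (by linarith : 0 ≤ 1 - 2 * t') (by linarith : 0 ≤ a - b),
        mul_pos (by linarith : 0 < 2 * t - 1) (by linarith : 0 < b - c)]
  · have : (t - t') * (b - c) = 0 := by linarith
    rcases mul_eq_zero.1 this with h | h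
    · linarith
    · exact absurd h hbc

/-- The bent arc is monotone in some coordinate. -/
def monoT (P M Q : Z2) : Prop :=
  ((P.1 < M.1 ∧ M.1 < Q.1) ∨ (M.1 < P.1 ∧ Q.1 < M.1)) ∨
  ((P.2 < M.2 ∧ M.2 < Q.2) ∨ (M.2 < P.2 ∧ Q.2 < M.2))

instance (P M Q : Z2) : Decidable (monoT P M Q) := by unfold monoT; infer_instance

lemma poly_inj {P M Q : Z2} (h : monoT P M Q) : InjOn (poly P M Q) (Icc (0:ℝ) 1) := by
  intro t ht t' ht' he
  have e1 : ∀ t, (poly P M Q t).1 = if t ≤ 1 / 2 then (P.1 : ℝ) + 2 * t * ((M.1 : ℝ) - P.1)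
      else (Q.1 : ℝ) + (2 - 2 * t) * ((M.1 : ℝ) - Q.1) := by
    intro t
    unfold poly seg
    split_ifs <;> rfl
  have e2 : ∀ t, (poly P M Q t).2 = if t ≤ 1 / 2 then (P.2 : ℝ) + 2 * t * ((M.2 : ℝ) - P.2)
      else (Q.2 : ℝ) + (2 - 2 * t) * ((M.2 : ℝ) - Q.2) := by
    intro t
    unfold poly seg
    split_ifs <;> rfl
  rcases h with h | h
  · refine bent_inj P.1 M.1 Q.1 (by exact_mod_cast h) ht ht' ?_
    rw [← e1, ← e1, he]
  · refine bent_inj P.2 M.2 Q.2 (by exact_mod_cast h) ht ht' ?_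
    rw [← e2, ← e2, he]

/-- One-sided separation of pieces. -/
def sep1 (P M Q N : Z2) : Prop :=
  (0 ≤ ori P M Q ∧ 0 < ori P M N) ∨ (ori P M Q ≤ 0 ∧ ori P M N < 0)

instance (P M Q N : Z2) : Decidable (sep1 P M Q N) := by unfold sep1; infer_instance

lemma sep1_disj {P M Q N : Z2} (h : sep1 P M Q N) {z : Plane} (h1 : z ∈ piece P M)
    (h2 : z ∈ piece Q N) : False := by
  obtain ⟨s, -, -, hs⟩ := h1
  obtain ⟨r, hr0, hr1, hr⟩ := h2
  rw [hs] at hr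
  unfold seg at hr
  rw [Prod.mk.injEq] at hr
  obtain ⟨ex, ey⟩ := hr
  have key : (1 - r) * ((ori P M Q : ℤ) : ℝ) + r * ((ori P M N : ℤ) : ℝ) = 0 := by
    unfold ori
    push_cast
    linear_combination ((M.2 : ℝ) - P.2) * ex - ((M.1 : ℝ) - P.1) * ey
  rcases h with ⟨ha, hb⟩ | ⟨ha, hb⟩
  · have ha : (0:ℝ) ≤ ((ori P M Q : ℤ) : ℝ) := by exact_mod_cast ha
    have hb : (0:ℝ) < ((ori P M N : ℤ) : ℝ) := by exact_mod_cast hb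
    nlinarith [mul_nonneg (by linarith : 0 ≤ 1 - r) ha, mul_pos hr0 hb]
  · have ha : ((ori P M Q : ℤ) : ℝ) ≤ 0 := by exact_mod_cast ha
    have hb : ((ori P M N : ℤ) : ℝ) < 0 := by exact_mod_cast hb
    nlinarith [mul_nonneg (by linarith : 0 ≤ 1 - r) (neg_nonneg.2 ha), mul_pos hr0 (neg_pos.2 hb)]

/-- Separation of pieces. -/
def sepT (A C : Z2 × Z2) : Prop := sep1 A.1 A.2 C.1 C.2 ∨ sep1 C.1 C.2 A.1 A.2

instance (A C : Z2 × Z2) : Decidable (sepT A C) := by unfold sepT; infer_instance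

/-- The point set of a piece given as a pair. -/
def pcs (A : Z2 × Z2) : Set Plane := piece A.1 A.2

lemma sepT_disj {A C : Z2 × Z2} (h : sepT A C) {z : Plane} (h1 : z ∈ pcs A) (h2 : z ∈ pcs C) :
    False := by
  rcases h with h | h
  · exact sep1_disj h h1 h2
  · exact sep1_disj h h2 h1

/-- Non-parallel pieces. -/
def npar (A C : Z2 × Z2) : Prop :=
  (A.2.1 - A.1.1) * (C.2.2 - C.1.2) - (A.2.2 - A.1.2) * (C.2.1 - C.1.1) ≠ 0

instance (A C : Z2 × Z2) : Decidable (npar A C) := by unfold npar; infer_instance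

lemma npar_eq {A C : Z2 × Z2} (h : npar A C) {z w : Plane} (h1 : z ∈ pcs A) (h2 : z ∈ pcs C)
    (h3 : w ∈ pcs A) (h4 : w ∈ pcs C) : z = w := by
  obtain ⟨P, M⟩ := A
  obtain ⟨Q, N⟩ := C
  obtain ⟨s, -, -, rfl⟩ := h1
  obtain ⟨r, -, -, hr⟩ := h2
  obtain ⟨s', -, -, rfl⟩ := h3
  obtain ⟨r', -, -, hr'⟩ := h4
  have h : ((M.1:ℝ) - P.1) * ((N.2:ℝ) - Q.2) - ((M.2:ℝ) - P.2) * ((N.1:ℝ) - Q.1) ≠ 0 := by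
    unfold npar at h
    exact_mod_cast h
  unfold seg at hr hr'
  simp only [Prod.mk.injEq] at hr hr'
  obtain ⟨ex, ey⟩ := hr
  obtain ⟨ex', ey'⟩ := hr'
  have : (s - s') *
      (((M.1:ℝ) - P.1) * ((N.2:ℝ) - Q.2) - ((M.2:ℝ) - P.2) * ((N.1:ℝ) - Q.1)) = 0 := by
    linear_combination ((N.2:ℝ) - Q.2) * (ex - ex') - ((N.1:ℝ) - Q.1) * (ey - ey')
  rcases mul_eq_zero.1 this with h' | h'
  · rw [sub_eq_zero.1 h']
  · exact absurd h' h

/-- The point `X` is off the piece. -/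
def offT (P M X : Z2) : Prop :=
  ori P M X ≠ 0 ∨ (X.1 - P.1) * (M.1 - P.1) + (X.2 - P.2) * (M.2 - P.2) ≤ 0 ∨
  (M.1 - P.1) * (M.1 - P.1) + (M.2 - P.2) * (M.2 - P.2) <
    (X.1 - P.1) * (M.1 - P.1) + (X.2 - P.2) * (M.2 - P.2)

instance (P M X : Z2) : Decidable (offT P M X) := by unfold offT; infer_instance

lemma offT_not {P M X : Z2} (hPM : P ≠ M) (h : offT P M X) : toR X ∉ piece P M := by
  rintro ⟨s, h0, h1, he⟩
  unfold toR seg at he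
  rw [Prod.mk.injEq] at he
  obtain ⟨ex, ey⟩ := he
  have hD : 0 < ((M.1:ℝ) - P.1) * (M.1 - P.1) + ((M.2:ℝ) - P.2) * (M.2 - P.2) := by
    rcases eq_or_ne P.1 M.1 with h1 | h1
    · have h2 : P.2 ≠ M.2 := fun h2 => hPM (Prod.ext h1 h2)
      have : (M.2:ℝ) - P.2 ≠ 0 := sub_ne_zero.2 (by exact_mod_cast h2.symm)
      have := mul_self_pos.2 this
      nlinarith [mul_self_nonneg ((M.1:ℝ) - P.1)]
    · have : (M.1:ℝ) - P.1 ≠ 0 := sub_ne_zero.2 (by exact_mod_cast h1.symm)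
      have := mul_self_pos.2 this
      nlinarith [mul_self_nonneg ((M.2:ℝ) - P.2)]
  have hd : ((X.1:ℝ) - P.1) * (M.1 - P.1) + ((X.2:ℝ) - P.2) * (M.2 - P.2) =
      s * (((M.1:ℝ) - P.1) * (M.1 - P.1) + ((M.2:ℝ) - P.2) * (M.2 - P.2)) := by
    linear_combination ((M.1:ℝ) - P.1) * ex + ((M.2:ℝ) - P.2) * ey
  rcases h with h | h | h
  · apply h
    have : ((ori P M X : ℤ) : ℝ) = 0 := by
      unfold ori
      push_cast
      linear_combination ((M.1:ℝ) - P.1) * ey - ((M.2:ℝ) - P.2) * ex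
    exact_mod_cast this
  · have h : ((X.1:ℝ) - P.1) * (M.1 - P.1) + ((X.2:ℝ) - P.2) * (M.2 - P.2) ≤ 0 := by
      exact_mod_cast h
    nlinarith [mul_pos h0 hD]
  · have h : ((M.1:ℝ) - P.1) * (M.1 - P.1) + ((M.2:ℝ) - P.2) * (M.2 - P.2) <
        ((X.1:ℝ) - P.1) * (M.1 - P.1) + ((X.2:ℝ) - P.2) * (M.2 - P.2) := by
      exact_mod_cast h
    nlinarith [mul_nonneg (by linarith : 0 ≤ 1 - s) hD.le]

/-- The zone of a page. -/
def lens : Set Plane :=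
  {z | (1000 - z.2 < z.1 ∨ 1000 + z.2 < z.1) ∧ z.1 < 4 * (1000 - z.2) ∧ z.1 < 4 * (1000 + z.2)}

/-- Sufficient test for a piece to lie in the zone. -/
def lensT (P M : Z2) : Prop :=
  ((1000 - P.2 ≤ P.1 ∧ 1000 - M.2 < M.1) ∨ (1000 + P.2 ≤ P.1 ∧ 1000 + M.2 < M.1)) ∧
  (P.1 ≤ 4 * (1000 - P.2) ∧ M.1 < 4 * (1000 - M.2)) ∧
  (P.1 ≤ 4 * (1000 + P.2) ∧ M.1 < 4 * (1000 + M.2))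

instance (P M : Z2) : Decidable (lensT P M) := by unfold lensT; infer_instance

lemma conv_pos {a b s : ℝ} (ha : 0 ≤ a) (hb : 0 < b) (h0 : 0 < s) (h1 : s ≤ 1) :
    0 < (1 - s) * a + s * b := by
  nlinarith [mul_nonneg (by linarith : 0 ≤ 1 - s) ha, mul_pos h0 hb]

lemma lensT_sub {P M : Z2} (h : lensT P M) : piece P M ⊆ lens := by
  rintro _ ⟨s, h0, h1, rfl⟩
  have h' : ((1000 - (P.2:ℝ) ≤ P.1 ∧ 1000 - (M.2:ℝ) < M.1) ∨
      (1000 + (P.2:ℝ) ≤ P.1 ∧ 1000 + (M.2:ℝ) < M.1)) ∧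
      ((P.1:ℝ) ≤ 4 * (1000 - P.2) ∧ (M.1:ℝ) < 4 * (1000 - M.2)) ∧
      ((P.1:ℝ) ≤ 4 * (1000 + P.2) ∧ (M.1:ℝ) < 4 * (1000 + M.2)) := by
    unfold lensT at h
    exact_mod_cast h
  obtain ⟨ha, ⟨hb1, hb2⟩, hc1, hc2⟩ := h'
  have hb := conv_pos (sub_nonneg.2 hb1) (sub_pos.2 hb2) h0 h1
  have hc := conv_pos (sub_nonneg.2 hc1) (sub_pos.2 hc2) h0 h1
  refine ⟨?_, ?_, ?_⟩
  · rcases ha with ⟨ha1, ha2⟩ | ⟨ha1, ha2⟩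
    · have ha := conv_pos (sub_nonneg.2 ha1) (sub_pos.2 ha2) h0 h1
      left
      simp only [seg]
      linarith
    · have ha := conv_pos (sub_nonneg.2 ha1) (sub_pos.2 ha2) h0 h1
      right
      simp only [seg]
      linarith
  · simp only [seg]
    linarith
  · simp only [seg]
    linarith

lemma lens_pos {z : Plane} (h : z ∈ lens) :
    0 < z.1 ∧ 0 < 1000 - z.2 ∧ 0 < 1000 + z.2 := by
  obtain ⟨h1 | h1, h2, h3⟩ := h <;> refine ⟨?_, ?_, ?_⟩ <;> linarith

/-- The stretching of page `i`. -/
def St (i : ℕ) (z : Plane) : Plane := (4 ^ i * z.1, z.2)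

lemma St_inj (i : ℕ) : Function.Injective (St i) := by
  intro z w h
  unfold St at h
  rw [Prod.mk.injEq] at h
  exact Prod.ext (mul_left_cancel₀ (by positivity) h.1) h.2

lemma St_cont (i : ℕ) : Continuous (St i) := by
  unfold St; fun_prop

lemma St_lt {i j : ℕ} (hij : i < j) {z w : Plane} (hz : z ∈ lens) (hw : w ∈ lens) :
    St i z ≠ St j w := by
  intro h
  unfold St at h
  rw [Prod.mk.injEq] at h
  obtain ⟨hx, hy⟩ := h
  have hp := lens_pos hw
  have hc : (0:ℝ) < 4 ^ i := by positivity
  have hd : (4:ℝ) ^ i * 4 ≤ 4 ^ j := by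
    rw [← pow_succ]
    exact pow_le_pow_right₀ (by norm_num) hij
  obtain ⟨-, h2, h3⟩ := hz
  obtain ⟨h1, -, -⟩ := hw
  rw [hy] at h2 h3
  have e1 : (4:ℝ) ^ i * 4 * w.1 ≤ 4 ^ j * w.1 := mul_le_mul_of_nonneg_right hd hp.1.le
  rcases h1 with h1 | h1
  · nlinarith [mul_lt_mul_of_pos_left h2 hc, mul_lt_mul_of_pos_left h1 hc]
  · nlinarith [mul_lt_mul_of_pos_left h3 hc, mul_lt_mul_of_pos_left h1 hc]

lemma St_page {i j : ℕ} {z w : Plane} (hz : z ∈ lens) (hw : w ∈ lens) (h : St i z = St j w) :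
    i = j := by
  rcases lt_trichotomy i j with hij | hij | hij
  · exact absurd h (St_lt hij hz hw)
  · exact hij
  · exact absurd h.symm (St_lt hij hw hz)

lemma St_pos {i : ℕ} {z : Plane} (hz : z ∈ lens) : 0 < (St i z).1 :=
  mul_pos (by positivity) (lens_pos hz).1

/-- Coordinates of the local labels. -/
def ptL : List Z2 :=
  [(0, -1000), (0, 1000), (1500, -200), (2500, -200), (2000, 100), (2000, -100), (2500, 200),
    (1500, 200), (-1000, 0), (1007, -500), (1382, -500), (1958, 0), (2229, 112), (1771, 112),
    (1382, 500), (1007, 500), (1771, -112), (1583, 0), (2229, -112), (2417, 0)]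

/-- Bends of the page edges. -/
def bndL : List Z2 :=
  [(555, -704), (925, -704), (740, -667), (3700, -40), (1100, 20), (1100, -20), (3700, 40),
    (740, 667), (925, 704), (555, 704), (1870, -200), (1685, -89), (1685, -163), (1500, -52),
    (2315, -89), (2315, -163), (2500, -52), (2000, 26), (2185, 137), (1815, 137), (2185, 11),
    (1815, 11), (2130, 200), (373, -815), (1318, -311), (511, -815), (2086, -311), (1984, 63),
    (1984, -63), (2085, 104), (2400, 167), (1915, 104), (1600, 167), (511, 815), (2086, 311),
    (373, 815), (1318, 311), (1600, -167), (1915, -104), (1531, -126), (1531, 126), (2400,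
    -167), (2085, -104), (2469, -126), (2469, 126)]

/-- Crossing partners of the page edges. -/
def prtL : List (Fin 45) :=
  [0, 1, 10, 6, 5, 4, 3, 22, 8, 9, 2, 21, 12, 13, 20, 15, 16, 17, 18, 19, 14, 11, 7, 23, 24,
    25, 26, 27, 28, 29, 30, 31, 32, 33, 34, 35, 36, 37, 38, 39, 40, 41, 42, 43, 44]

/-- Bends of the common edges. -/
def cbL : List Z2 := [(0, 300), (-400, -600), (-400, 600)]

/-- Coordinates of a local label. -/
def lpt (a : Fin 20) : Z2 := ptL.getD a.val (0, 0)

/-- Bend of a page edge. -/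
def bnd (e : Fin 45) : Z2 := bndL.getD e.val (0, 0)

/-- Crossing partner of a page edge. -/
def prt (e : Fin 45) : Fin 45 := prtL.getD e.val 0

/-- Bend of a common edge. -/
def cb (e : Fin 3) : Z2 := cbL.getD e.val (0, 0)

/-- The pieces of a page edge. -/
def pcE (e : Fin 45) (b : Bool) : Z2 × Z2 :=
  (lpt (if b then (pE e).2 else (pE e).1), bnd e)

/-- The pieces of a common edge. -/
def pcC (e : Fin 3) (b : Bool) : Z2 × Z2 :=
  (lpt (if b then (cE e).2 else (cE e).1), cb e)

lemma chk_mono : ∀ e : Fin 45, monoT (lpt (pE e).1) (bnd e) (lpt (pE e).2) := by decide +kernel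

lemma chk_monoC : ∀ e : Fin 3, monoT (lpt (cE e).1) (cb e) (lpt (cE e).2) := by decide +kernel

lemma chk_lens : ∀ (e : Fin 45) (b : Bool), lensT (pcE e b).1 (pcE e b).2 := by decide +kernel

lemma chk_neg : ∀ (e : Fin 3) (b : Bool), (pcC e b).1.1 ≤ 0 ∧ (pcC e b).2.1 ≤ 0 := by
  decide +kernel

lemma chk_off : ∀ (e : Fin 45) (b : Bool) (a : Fin 20),
    (pcE e b).1 ≠ (pcE e b).2 ∧ offT (pcE e b).1 (pcE e b).2 (lpt a) := by decide +kernel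

lemma chk_offC : ∀ (e : Fin 3) (b : Bool) (a : Fin 20),
    (pcC e b).1 ≠ (pcC e b).2 ∧ offT (pcC e b).1 (pcC e b).2 (lpt a) := by decide +kernel

lemma chk_prv : ∀ a : Fin 20, prv a = true → lensT (lpt a) (lpt a) := by decide +kernel

lemma chk_inj : ∀ a b : Fin 20, lpt a = lpt b → a = b := by decide +kernel

lemma chk_shared : ∀ c : Fin 3, (lpt (unsh (.inl c))).1 ≤ 0 := by decide +kernel

lemma chk_ends : ∀ e : Fin 45, ((pE e).1 = 0 ∨ (pE e).1 = 1 ∨ prv (pE e).1 = true) := by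
  decide +kernel

lemma chk_sepC : ∀ e f : Fin 3, e ≠ f → ∀ a b : Bool, sepT (pcC e a) (pcC f b) := by
  decide +kernel

lemma chk_sep : ∀ e f : Fin 45, e ≠ f → (∀ a b : Bool, sepT (pcE e a) (pcE f b)) ∨
    (prt e = f ∧ ((pE e).1 ≠ (pE f).1 ∧ (pE e).1 ≠ (pE f).2 ∧ (pE e).2 ≠ (pE f).1 ∧
      (pE e).2 ≠ (pE f).2) ∧
      ∃ a b : Bool, npar (pcE e a) (pcE f b) ∧
        ∀ a' b' : Bool, ¬ (a' = a ∧ b' = b) → sepT (pcE e a') (pcE f b')) := by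
  decide +kernel

/-- Local arc of a page edge. -/
def parc (e : Fin 45) : ℝ → Plane := poly (lpt (pE e).1) (bnd e) (lpt (pE e).2)

/-- Arc of a common edge. -/
def carc (e : Fin 3) : ℝ → Plane := poly (lpt (cE e).1) (cb e) (lpt (cE e).2)

lemma parc_pc {e : Fin 45} {z : Plane} (h : z ∈ parc e '' Ioo 0 1) : ∃ b, z ∈ pcs (pcE e b) := by
  rcases poly_sub _ _ _ h with h | h
  · exact ⟨false, h⟩
  · exact ⟨true, h⟩

lemma carc_pc {e : Fin 3} {z : Plane} (h : z ∈ carc e '' Ioo 0 1) : ∃ b, z ∈ pcs (pcC e b) := by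
  rcases poly_sub _ _ _ h with h | h
  · exact ⟨false, h⟩
  · exact ⟨true, h⟩

lemma parc_lens {e : Fin 45} {z : Plane} (h : z ∈ parc e '' Ioo 0 1) : z ∈ lens := by
  obtain ⟨b, hb⟩ := parc_pc h
  exact lensT_sub (chk_lens e b) hb

lemma carc_neg {e : Fin 3} {z : Plane} (h : z ∈ carc e '' Ioo 0 1) : z.1 ≤ 0 := by
  obtain ⟨b, s, h0, h1, rfl⟩ := carc_pc h
  obtain ⟨h2, h3⟩ := chk_neg e b
  have h2 : ((pcC e b).1.1 : ℝ) ≤ 0 := by exact_mod_cast h2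
  have h3 : ((pcC e b).2.1 : ℝ) ≤ 0 := by exact_mod_cast h3
  simp only [seg]
  nlinarith [mul_nonneg (by linarith : 0 ≤ 1 - s) (neg_nonneg.2 h2),
    mul_nonneg h0.le (neg_nonneg.2 h3)]

lemma parc_off (e : Fin 45) (a : Fin 20) : toR (lpt a) ∉ parc e '' Ioo 0 1 := by
  intro h
  obtain ⟨b, hb⟩ := parc_pc h
  exact offT_not (chk_off e b a).1 (chk_off e b a).2 hb

lemma carc_off (e : Fin 3) (a : Fin 20) : toR (lpt a) ∉ carc e '' Ioo 0 1 := by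
  intro h
  obtain ⟨b, hb⟩ := carc_pc h
  exact offT_not (chk_offC e b a).1 (chk_offC e b a).2 hb

lemma carc_disj {e f : Fin 3} (hef : e ≠ f) {z : Plane} (h : z ∈ carc e '' Ioo 0 1)
    (h' : z ∈ carc f '' Ioo 0 1) : False := by
  obtain ⟨a, ha⟩ := carc_pc h
  obtain ⟨b, hb⟩ := carc_pc h'
  exact sepT_disj (chk_sepC e f hef a b) ha hb

lemma parc_cross {e f : Fin 45} (hef : e ≠ f) {z : Plane} (h : z ∈ parc e '' Ioo 0 1)
    (h' : z ∈ parc f '' Ioo 0 1) : prt e = f ∧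
      ((pE e).1 ≠ (pE f).1 ∧ (pE e).1 ≠ (pE f).2 ∧ (pE e).2 ≠ (pE f).1 ∧ (pE e).2 ≠ (pE f).2) ∧
      ∀ w, w ∈ parc e '' Ioo 0 1 → w ∈ parc f '' Ioo 0 1 → z = w := by
  obtain ⟨a, ha⟩ := parc_pc h
  obtain ⟨b, hb⟩ := parc_pc h'
  rcases chk_sep e f hef with hs | ⟨h1, h2, a0, b0, h3, h4⟩
  · exact (sepT_disj (hs a b) ha hb).elim
  · refine ⟨h1, h2, fun w hw hw' => ?_⟩
    obtain ⟨c, hc⟩ := parc_pc hw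
    obtain ⟨d, hd⟩ := parc_pc hw'
    have hab : a = a0 ∧ b = b0 := by
      by_contra hn
      exact sepT_disj (h4 a b hn) ha hb
    have hcd : c = a0 ∧ d = b0 := by
      by_contra hn
      exact sepT_disj (h4 c d hn) hc hd
    obtain ⟨rfl, rfl⟩ := hab
    obtain ⟨rfl, rfl⟩ := hcd
    exact npar_eq h3 ha hb hc hd

/-- Position of the vertices. -/
def gpos {k : ℕ} : W k → Plane
  | .inl c => toR (lpt (unsh (.inl c)))
  | .inr (i, d) => St i.val (toR (lpt (unsh (.inr d))))

/-- Arcs of the edges. -/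
def garc {k : ℕ} : J k → ℝ → Plane
  | .inl e => carc e
  | .inr (i, e) => fun t => St i.val (parc e t)

lemma toR_inj {P Q : Z2} (h : toR P = toR Q) : P = Q := by
  unfold toR at h
  rw [Prod.mk.injEq] at h
  exact Prod.ext (by exact_mod_cast h.1) (by exact_mod_cast h.2)

lemma prv_lens {a : Fin 20} (h : prv a = true) : toR (lpt a) ∈ lens := by
  refine lensT_sub (chk_prv a h) ⟨1, one_pos, le_rfl, ?_⟩
  unfold toR seg
  simp

lemma prv_inr (d : Fin 17) : prv (unsh (.inr d)) = true := by
  unfold prv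
  rw [sh_unsh]
  rfl

lemma gpos_inl_neg {k : ℕ} (c : Fin 3) : (gpos (k := k) (.inl c)).1 ≤ 0 := by
  have := chk_shared c
  show ((lpt (unsh (.inl c))).1 : ℝ) ≤ 0
  exact_mod_cast this

lemma unsh_inj {s t : Fin 3 ⊕ Fin 17} (h : unsh s = unsh t) : s = t := by
  rw [← sh_unsh s, h, sh_unsh]

lemma gpos_inj {k : ℕ} : Function.Injective (gpos (k := k)) := by
  intro x y h
  rcases x with c | ⟨i, d⟩ <;> rcases y with c' | ⟨j, d'⟩
  · have := unsh_inj (chk_inj _ _ (toR_inj h))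
    simpa using this
  · exfalso
    have h1 := gpos_inl_neg (k := k) c
    rw [h] at h1
    exact absurd (St_pos (i := j.val) (prv_lens (prv_inr d'))) (not_lt.2 h1)
  · exfalso
    have h1 := gpos_inl_neg (k := k) c'
    rw [← h] at h1
    exact absurd (St_pos (i := i.val) (prv_lens (prv_inr d))) (not_lt.2 h1)
  · have hij : i.val = j.val := St_page (prv_lens (prv_inr d)) (prv_lens (prv_inr d')) h
    have hij : i = j := Fin.ext hij
    subst hij
    have := unsh_inj (chk_inj _ _ (toR_inj (St_inj _ h)))
    simp only [Sum.inr.injEq] at this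
    rw [this]

lemma gpos_loc {k : ℕ} (i : Fin k) {a : Fin 20} (ha : a = 0 ∨ a = 1 ∨ prv a = true) :
    gpos (loc i a) = St i.val (toR (lpt a)) := by
  rcases ha with rfl | rfl | ha
  · show toR (lpt 0) = _
    simp [St, toR, lpt, ptL]
  · show toR (lpt 1) = _
    simp [St, toR, lpt, ptL]
  · unfold prv at ha
    unfold loc
    cases hs : sh a with
    | inl c => rw [hs] at ha; simp at ha
    | inr d =>
      show St i.val (toR (lpt (unsh (.inr d)))) = _
      rw [← hs, unsh_sh]

lemma gpos_com {k : ℕ} : ∀ e : Fin 3, gpos (com k (cE e).1) = toR (lpt (cE e).1) ∧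
    gpos (com k (cE e).2) = toR (lpt (cE e).2) := by
  intro e
  obtain ⟨h1, h2⟩ := cE_lab (k := k) e
  constructor
  · show toR (lpt (lab (com k (cE e).1))) = _
    rw [h1]
  · show toR (lpt (lab (com k (cE e).2))) = _
    rw [h2]

lemma garc_img {k : ℕ} {i : Fin k} {e : Fin 45} {z : Plane}
    (h : z ∈ garc (k := k) (.inr (i, e)) '' Ioo 0 1) :
    ∃ w, w ∈ parc e '' Ioo 0 1 ∧ w ∈ lens ∧ z = St i.val w := by
  obtain ⟨t, ht, rfl⟩ := h
  exact ⟨parc e t, ⟨t, ht, rfl⟩, parc_lens ⟨t, ht, rfl⟩, rfl⟩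

/-- The crossings of the drawing. -/
lemma garc_cross {k : ℕ} {x y : J k} (hxy : x ≠ y) {z : Plane} (hx : z ∈ garc x '' Ioo 0 1)
    (hy : z ∈ garc y '' Ioo 0 1) :
    ∃ (i : Fin k) (e : Fin 45), x = .inr (i, e) ∧ y = .inr (i, prt e) ∧ e ≠ prt e ∧
      ∃ w, z = St i.val w ∧ w ∈ parc e '' Ioo 0 1 ∧ w ∈ parc (prt e) '' Ioo 0 1 := by
  rcases x with e | ⟨i, e⟩ <;> rcases y with f | ⟨j, f⟩
  · exact (carc_disj (fun h => hxy (by rw [h])) hx hy).elim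
  · exfalso
    obtain ⟨w, -, hw, rfl⟩ := garc_img hy
    exact absurd (St_pos (i := j.val) hw) (not_lt.2 (carc_neg hx))
  · exfalso
    obtain ⟨w, -, hw, rfl⟩ := garc_img hx
    exact absurd (St_pos (i := i.val) hw) (not_lt.2 (carc_neg hy))
  · obtain ⟨w, hw1, hw2, rfl⟩ := garc_img hx
    obtain ⟨w', hv1x, hv2x, h⟩ := garc_img hy
    have hij : i = j := Fin.ext (St_page hw2 hv2x h)
    subst hij
    have := St_inj _ h
    subst this
    have hef : e ≠ f := fun h => hxy (by rw [h])
    obtain ⟨h1, -, -⟩ := parc_cross hef hw1 hv1x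
    subst h1
    exact ⟨i, e, rfl, rfl, hef, w, rfl, hw1, hv1x⟩

/-- The drawing of the graph. -/
def gdraw (k : ℕ) : MultiDrawing (W k) (J k) (iota k) where
  pos := gpos
  pos_inj := gpos_inj
  arc := garc
  arc_cont := by
    rintro (e | ⟨i, e⟩)
    · exact (poly_cont _ _ _).continuousOn
    · exact ((St_cont i.val).comp (poly_cont _ _ _)).continuousOn
  arc_inj := by
    rintro (e | ⟨i, e⟩)
    · exact poly_inj (chk_monoC e)
    · intro t ht t' ht' h
      exact poly_inj (chk_mono e) ht ht' (St_inj _ h)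
  arc_ends := by
    rintro (e | ⟨i, e⟩)
    · refine ⟨_, _, rfl, ?_, ?_⟩
      · rw [(gpos_com e).1]
        exact poly_zero _ _ _
      · rw [(gpos_com e).2]
        exact poly_one _ _ _
    · refine ⟨_, _, rfl, ?_, ?_⟩
      · rw [gpos_loc i (chk_ends e)]
        exact congrArg (St i.val) (poly_zero _ _ _)
      · rw [gpos_loc i (Or.inr (Or.inr (pE_prv e)))]
        exact congrArg (St i.val) (poly_one _ _ _)
  arc_avoid := by
    rintro (e | ⟨i, e⟩) (c | ⟨j, d⟩) h
    · exact carc_off e _ h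
    · exact absurd (St_pos (i := j.val) (prv_lens (prv_inr d))) (not_lt.2 (carc_neg h))
    · obtain ⟨w, -, hw, hz⟩ := garc_img h
      have h1 := gpos_inl_neg (k := k) c
      rw [hz] at h1
      exact absurd (St_pos (i := i.val) hw) (not_lt.2 h1)
    · obtain ⟨w, hw1, hw, hz⟩ := garc_img h
      have hij : j = i := Fin.ext (St_page (prv_lens (prv_inr d)) hw hz)
      subst hij
      have := St_inj _ hz
      rw [← this] at hw1
      exact parc_off e _ hw1
  no_incident_cross := by
    intro x y hxy hne v hv
    obtain ⟨z, hz1, hz2⟩ := hne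
    obtain ⟨i, e, rfl, rfl, hef, w, -, hw1, hw2⟩ := garc_cross hxy hz1 hz2
    obtain ⟨-, ⟨h1, h2, h3, h4⟩, -⟩ := parc_cross hef hw1 hw2
    obtain ⟨hv1, hv2⟩ := hv
    simp only [iota, Sym2.mem_iff] at hv1 hv2
    rcases hv1 with rfl | rfl <;> rcases hv2 with hv2 | hv2
    · exact h1 (loc_inj i hv2)
    · exact h2 (loc_inj i hv2)
    · exact h3 (loc_inj i hv2)
    · exact h4 (loc_inj i hv2)

lemma gdraw_one (k : ℕ) : (gdraw k).IsOnePlanarD := by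
  rintro x ⟨f, z⟩ ⟨hf, hz1, hz2⟩ ⟨g, z'⟩ ⟨hg, hz1', hz2'⟩
  obtain ⟨i, e, h1, h2, hef, w, rfl, hw1, hw2⟩ := garc_cross (Ne.symm hf) hz1 hz2
  obtain ⟨i', e', h1', h2', -, w', rfl, hv1x, hv2x⟩ := garc_cross (Ne.symm hg) hz1' hz2'
  rw [h1] at h1'
  simp only [Sum.inr.injEq, Prod.mk.injEq] at h1'
  obtain ⟨rfl, rfl⟩ := h1'
  simp only at h2 h2'
  rw [h2, h2', (parc_cross hef hw1 hw2).2.2 w' hv1x hv2x]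

/-! ### Part 5: transport and conclusion -/

/-- Relabelling a drawing. -/
def MultiDrawing.reindex {V V' E E' : Type} {ends : E → Sym2 V} {ends' : E' → Sym2 V'}
    (D : MultiDrawing V E ends) (φ : V ≃ V') (ψ : E' ≃ E)
    (h : ∀ e, ends' e = Sym2.map φ (ends (ψ e))) : MultiDrawing V' E' ends' where
  pos v := D.pos (φ.symm v)
  pos_inj := D.pos_inj.comp φ.symm.injective
  arc e := D.arc (ψ e)
  arc_cont e := D.arc_cont _
  arc_inj e := D.arc_inj _
  arc_ends e := by
    obtain ⟨u, v, h1, h2, h3⟩ := D.arc_ends (ψ e)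
    refine ⟨φ u, φ v, ?_, ?_, ?_⟩
    · rw [h, h1, Sym2.map_mk]
    · rw [h2, φ.symm_apply_apply]
    · rw [h3, φ.symm_apply_apply]
  arc_avoid e w := D.arc_avoid _ _
  no_incident_cross e f hef hne x hx := by
    refine D.no_incident_cross (ψ e) (ψ f) (fun h => hef (ψ.injective h)) hne (φ.symm x) ?_
    rw [h, h, Sym2.mem_map, Sym2.mem_map] at hx
    obtain ⟨⟨a, ha, rfl⟩, ⟨b, hb, hab⟩⟩ := hx
    have := φ.injective hab
    subst this
    rw [φ.symm_apply_apply]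
    exact ⟨ha, hb⟩

lemma MultiDrawing.reindex_one {V V' E E' : Type} {ends : E → Sym2 V} {ends' : E' → Sym2 V'}
    (D : MultiDrawing V E ends) (φ : V ≃ V') (ψ : E' ≃ E)
    (h : ∀ e, ends' e = Sym2.map φ (ends (ψ e))) (hD : D.IsOnePlanarD) :
    (D.reindex φ ψ h).IsOnePlanarD := by
  rintro e ⟨f, z⟩ ⟨hf, hz⟩ ⟨g, w⟩ ⟨hg, hw⟩
  have hz' : ((ψ f, z) : E × Plane) ∈ D.crossSet (ψ e) := ⟨fun h => hf (ψ.injective h), hz⟩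
  have hw' : ((ψ g, w) : E × Plane) ∈ D.crossSet (ψ e) := ⟨fun h => hg (ψ.injective h), hw⟩
  have := hD (ψ e) hz' hw'
  rw [Prod.mk.injEq] at this
  rw [ψ.injective this.1, this.2]

lemma GG_one (k : ℕ) : (GG k).IsOnePlanar := by
  have ψ : ∃ ψ : ↥(GG k).edgeSet ≃ J k, ∀ e, iota k (ψ e) = (e : Sym2 (W k)) := by
    rw [GG_edgeSet]
    refine ⟨(Equiv.ofInjective _ (iota_inj k)).symm, fun e => ?_⟩
    exact Equiv.apply_ofInjective_symm (iota_inj k) e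
  obtain ⟨ψ, hψ⟩ := ψ
  refine ⟨(gdraw k).reindex (Equiv.refl _) ψ ?_, MultiDrawing.reindex_one _ _ _ _ (gdraw_one k)⟩
  intro e
  rw [hψ]
  simp

lemma onePlanar_iso {V V' : Type} {G : SimpleGraph V} {G' : SimpleGraph V'} (φ : G ≃g G')
    (h : G.IsOnePlanar) : G'.IsOnePlanar := by
  obtain ⟨D, hD⟩ := h
  refine ⟨D.reindex φ.toEquiv φ.symm.mapEdgeSet ?_, MultiDrawing.reindex_one _ _ _ _ hD⟩
  intro e
  obtain ⟨e, he⟩ := e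
  induction e with
  | _ a b =>
    show s(a, b) = s(φ (φ.symm a), φ (φ.symm b))
    simp

lemma max_iso {V V' : Type} {G : SimpleGraph V} {G' : SimpleGraph V'} (φ : G ≃g G')
    (h : MaximalOnePlanar G) : MaximalOnePlanar G' := by
  refine ⟨onePlanar_iso φ h.1, fun H hH h1 => ?_⟩
  let ψ : H.comap φ.toEquiv ≃g H := SimpleGraph.Iso.comap φ.toEquiv H
  refine h.2 (H.comap φ.toEquiv) (lt_of_le_of_ne ?_ ?_) (onePlanar_iso ψ.symm h1)
  · intro a b hab
    exact hH.le (φ.map_adj_iff.2 hab)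
  · intro he
    refine hH.not_ge fun a b hab => ?_
    have h2 : (H.comap φ.toEquiv).Adj (φ.symm a) (φ.symm b) := by
      show H.Adj (φ (φ.symm a)) (φ (φ.symm b))
      simpa using hab
    have : ∀ x y, (H.comap φ.toEquiv).Adj x y → G.Adj x y := fun x y hxy => by
      rw [he]
      exact hxy
    have := this _ _ h2
    simpa using φ.map_adj_iff.2 this

/-- There are sparse maximal 1-planar graphs: for infinitely
many `n` there is a maximal 1-planar graph on `n` vertices with exactly
`(45 n − 84)/17` edges. -/
theorem sparse_maximal_one_planar :
    {n : ℕ | ∃ G : SimpleGraph (Fin n), MaximalOnePlanar G ∧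
      17 * G.edgeSet.ncard = 45 * n - 84}.Infinite := by
  refine Set.infinite_of_injective_forall_mem (f := fun k : ℕ => 17 * (k + 1) + 3)
    (fun a b h => by simp only at h; omega) fun k => ?_
  have hc : Fintype.card (W (k + 1)) = 17 * (k + 1) + 3 := by
    simp only [W, Fintype.card_sum, Fintype.card_prod, Fintype.card_fin]
    ring
  let φ : W (k + 1) ≃ Fin (17 * (k + 1) + 3) := Fintype.equivFinOfCardEq hc
  let ψ : GG (k + 1) ≃g (GG (k + 1)).map φ.toEmbedding := SimpleGraph.Iso.map φ _
  refine ⟨(GG (k + 1)).map φ.toEmbedding,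
    max_iso ψ ⟨GG_one _, fun H hH => GG_max (Nat.succ_pos k) hH⟩, ?_⟩
  have h1 : ((GG (k + 1)).map φ.toEmbedding).edgeSet.ncard = 45 * (k + 1) + 3 := by
    rw [← GG_ncard, ← Nat.card_coe_set_eq, ← Nat.card_coe_set_eq]
    exact (Nat.card_congr ψ.mapEdgeSet).symm
  rw [h1]
  omega
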